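/- For every non-negative integer k there exist a positive integer m = m(k) and a constant C_k > 0 such that for all T ≥ 2: the set of zeros of Z_k in the region {s = σ + it : 1 − 2m < σ < 2m, 0 ≤ t ≤ T} is finite, and its cardinality N(T, Z_k) (counted with multiplicity) satisfies | N(T, Z_k) − (T/2π) log(T/2π) + T/2π | ≤ C_k log T. -/

import Mathlib

open Complex Finset

noncomputable def chi (s : ℂ) : ℂ :=
  2 ^ s * (Real.pi : ℂ) ^ (s - 1) * Complex.sin (Real.pi * s / 2) * Complex.Gamma (1 - s)

noncomputable def omega (s : ℂ) : ℂ :=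
  Real.log (2 * Real.pi) + deriv Complex.Gamma s / Complex.Gamma s
    - (Real.pi / 2) * Complex.tan (Real.pi * s / 2)

noncomputable def Zk : ℕ → ℂ → ℂ
  | 0 => riemannZeta
  | k + 1 => fun s => deriv (Zk k) s - (1 / 2) * omega s * Zk k s

noncomputable def fk : ℕ → ℂ → ℂ
  | 0 => fun _ => 1
  | k + 1 => fun s => deriv (fk k) s - (1 / 2) * omega s * fk k s

noncomputable def scrZ (k : ℕ) (T : ℝ) (s : ℂ) : ℂ :=
  ∑ μ ∈ Finset.range (k + 1),
    (k.choose μ : ℂ) * ((Real.log (T / (2 * Real.pi)) : ℂ) / 2) ^ (k - μ)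
      * iteratedDeriv μ riemannZeta s

/-- Order of vanishing of `f` at `ρ`: the least `n` with nonvanishing `n`-th derivative
(for analytic `f` this is the multiplicity of the zero). -/
noncomputable def zeroOrder (f : ℂ → ℂ) (ρ : ℂ) : ℕ :=
  sInf {n : ℕ | iteratedDeriv n f ρ ≠ 0}

open Filter Topology Metric in
theorem tendsto_deriv_of_tendsto_of_norm_le {F : ℕ → ℂ → ℂ} {f : ℂ → ℂ} {U : Set ℂ} {z : ℂ}
    {r M : ℝ} (hU : IsOpen U) (hr : 0 < r) (hz : closedBall z r ⊆ U)
    (hF : ∀ᶠ n in atTop, DifferentiableOn ℂ (F n) U) (hf : DifferentiableOn ℂ f U)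
    (hb : ∀ᶠ n in atTop, ∀ w ∈ sphere z r, ‖F n w‖ ≤ M)
    (hlim : ∀ w ∈ sphere z r, Tendsto (fun n => F n w) atTop (𝓝 (f w))) :
    Tendsto (fun n => deriv (F n) z) atTop (𝓝 (deriv f z)) := by
  have h1 : Tendsto (fun n => cderiv r (F n) z) atTop (𝓝 (cderiv r f z)) := by
    unfold cderiv circleIntegral
    refine Tendsto.const_smul ?_ _
    refine intervalIntegral.tendsto_integral_filter_of_dominated_convergence
      (fun _ => r * ((r ^ 2)⁻¹ * M)) ?_ ?_ (by simp) ?_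
    · filter_upwards [hF] with n hn
      apply ContinuousOn.aestronglyMeasurable _ measurableSet_uIoc
      apply Continuous.continuousOn
      have hc : Continuous fun θ : ℝ => F n (circleMap z r θ) := by
        refine hn.continuousOn.comp_continuous (continuous_circleMap z r) fun θ => hz ?_
        exact sphere_subset_closedBall (circleMap_mem_sphere z hr.le θ)
      have hd : ∀ θ, (circleMap z r θ - z) ^ 2 ≠ 0 := fun θ => by
        simp [circleMap, hr.ne']
      have h2 : Continuous fun θ : ℝ => ((circleMap z r θ - z) ^ 2)⁻¹ :=
        Continuous.inv₀ (((continuous_circleMap z r).sub continuous_const).pow 2) hd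
      have h3 : Continuous (deriv (circleMap z r)) := by
        rw [show deriv (circleMap z r) = fun θ => circleMap 0 r θ * I from
          funext fun θ => deriv_circleMap z r θ]
        fun_prop
      exact h3.smul (h2.smul hc)
    · filter_upwards [hb] with n hn
      refine Eventually.of_forall fun θ _ => ?_
      have := hn _ (circleMap_mem_sphere z hr.le θ)
      simp only [deriv_circleMap, norm_smul, norm_mul, norm_circleMap_zero, norm_I, mul_one,
        norm_inv, norm_pow, circleMap_sub_center, abs_of_pos hr]
      gcongr
    · refine Eventually.of_forall fun θ _ => ?_
      exact ((hlim _ (circleMap_mem_sphere z hr.le θ)).const_smul _).const_smul _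
  have h2 := cderiv_eq_deriv hU hf hr hz
  rw [h2] at h1
  refine h1.congr' ?_
  filter_upwards [hF] with n hn using cderiv_eq_deriv hU hn hr hz

theorem norm_GammaSeq_le {s : ℂ} (hs : 0 < s.re) {n : ℕ} (hn : n ≠ 0) :
    ‖GammaSeq s n‖ ≤ Real.Gamma s.re := by
  have h := Real.BohrMollerup.ge_logGammaSeq Real.convexOn_log_Gamma (fun {y} hy => by
    simp only [Function.comp]
    rw [Real.Gamma_add_one hy.ne', Real.log_mul hy.ne' (Real.Gamma_pos_of_pos hy).ne', add_comm])
    hs hn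
  simp only [Function.comp, Real.Gamma_one, Real.log_one, zero_add] at h
  have hn' : (0 : ℝ) < n := by positivity
  have hj : ∀ j ∈ range (n + 1), 0 < s.re + j := fun j _ => by positivity
  have h1 : ‖GammaSeq s n‖ ≤ (n : ℝ) ^ s.re * n.factorial / ∏ j ∈ range (n + 1), (s.re + j) := by
    unfold GammaSeq
    rw [norm_div, norm_mul, norm_prod, norm_natCast, norm_natCast_cpow_of_pos (by omega)]
    have : ∏ j ∈ range (n + 1), (s.re + j) ≤ ∏ j ∈ range (n + 1), ‖s + j‖ := by
      refine Finset.prod_le_prod (fun j hj' => (hj j hj').le) fun j _ => ?_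
      simpa using re_le_norm (s + j)
    have := Finset.prod_pos hj
    gcongr
  refine h1.trans ?_
  rw [← Real.exp_log (Real.Gamma_pos_of_pos hs)]
  refine le_trans (le_of_eq ?_) (Real.exp_le_exp.2 h)
  unfold Real.BohrMollerup.logGammaSeq
  rw [Real.exp_sub, Real.exp_add, Real.exp_sum, Real.exp_log (by positivity), mul_comm s.re,
    ← Real.rpow_def_of_pos hn']
  congr 1
  exact Finset.prod_congr rfl fun j hj' => (Real.exp_log (hj j hj')).symm

theorem logDeriv_GammaSeq {s : ℂ} (hs : 0 < s.re) {n : ℕ} (hn : n ≠ 0) :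
    DifferentiableAt ℂ (fun s => GammaSeq s n) s ∧
    logDeriv (fun s => GammaSeq s n) s = Real.log n - ∑ j ∈ range (n + 1), 1 / (s + j) := by
  have hj : ∀ j : ℕ, s + j ≠ 0 := fun j h => by
    have := congrArg re h
    simp at this
    have : (0 : ℝ) ≤ j := by positivity
    linarith
  have hn' : (n : ℂ) ≠ 0 := by exact_mod_cast hn
  have hP : ∏ j ∈ range (n + 1), (s + j) ≠ 0 := Finset.prod_ne_zero_iff.2 fun j _ => hj j
  have hdP : DifferentiableAt ℂ (fun s : ℂ => ∏ j ∈ range (n + 1), (s + j)) s := by fun_prop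
  have hd1 : DifferentiableAt ℂ (fun s : ℂ => (n : ℂ) ^ s) s := by
    apply DifferentiableAt.const_cpow differentiableAt_id (Or.inl hn')
  have hd2 : DifferentiableAt ℂ (fun s : ℂ => (n : ℂ) ^ s * n.factorial) s := hd1.mul_const _
  have hfac : (n.factorial : ℂ) ≠ 0 := by exact_mod_cast n.factorial_ne_zero
  have hnum : (n : ℂ) ^ s * n.factorial ≠ 0 := by simp [cpow_eq_zero_iff, hn', hfac]
  unfold GammaSeq
  refine ⟨hd2.div hdP hP, ?_⟩
  rw [logDeriv_div s hnum hP hd2 hdP, logDeriv_prod]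
  · congr 1
    · have hd : HasDerivAt (fun x : ℂ => (n : ℂ) ^ x) ((n : ℂ) ^ s * log n * 1) s :=
        (hasDerivAt_id s).const_cpow (Or.inl hn')
      have hne : (n : ℂ) ^ s ≠ 0 := by simp [cpow_eq_zero_iff, hn']
      rw [logDeriv_mul_const _ _ hfac, logDeriv_apply, hd.deriv, ← natCast_log]
      field_simp
    · refine Finset.sum_congr rfl fun j _ => ?_
      simp [logDeriv_apply]
  · exact fun j _ => hj j
  · exact fun j _ => by fun_prop


open Filter Topology Metric in
theorem tendsto_log_sub_sum_digamma {s : ℂ} (hs : 0 < s.re) :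
    Tendsto (fun n : ℕ => (Real.log n : ℂ) - ∑ j ∈ range (n + 1), 1 / (s + j)) atTop
      (𝓝 (digamma s)) := by
  have hU : IsOpen {w : ℂ | 0 < w.re} := isOpen_lt continuous_const continuous_re
  have hsub : closedBall s (s.re / 2) ⊆ {w : ℂ | 0 < w.re} := fun w hw => by
    have h1 := (abs_re_le_norm (w - s)).trans (mem_closedBall_iff_norm.1 hw)
    have := (abs_le.1 h1).1
    simp at this ⊢
    linarith
  have hG : DifferentiableOn ℂ Gamma {w : ℂ | 0 < w.re} := fun w hw =>
    (differentiableAt_Gamma w fun m h => by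
      have h2 := congrArg re h
      simp at h2 hw
      have : (0 : ℝ) ≤ m := by positivity
      linarith).differentiableWithinAt
  have hcont : ContinuousOn (fun w : ℂ => Real.Gamma w.re) (sphere s (s.re / 2)) := by
    intro w hw
    have hw' : 0 < w.re := hsub (sphere_subset_closedBall hw)
    have := (Real.differentiableAt_Gamma (s := w.re) fun m h => by
      have : (0 : ℝ) ≤ m := by positivity
      linarith).continuousAt
    exact (ContinuousAt.comp (f := re) this continuous_re.continuousAt).continuousWithinAt
  obtain ⟨M, hM⟩ := (isCompact_sphere s (s.re / 2)).exists_bound_of_continuousOn hcont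
  have hne : Gamma s ≠ 0 := Gamma_ne_zero_of_re_pos hs
  have key : Tendsto (fun n : ℕ => deriv (fun w => GammaSeq w n) s) atTop (𝓝 (deriv Gamma s)) := by
    refine tendsto_deriv_of_tendsto_of_norm_le (M := M) hU (half_pos hs) hsub ?_ hG ?_
      fun w _ => GammaSeq_tendsto_Gamma w
    · filter_upwards [eventually_ne_atTop 0] with n hn w hw
      exact (logDeriv_GammaSeq hw hn).1.differentiableWithinAt
    · filter_upwards [eventually_ne_atTop 0] with n hn w hw
      exact (norm_GammaSeq_le (hsub (sphere_subset_closedBall hw)) hn).trans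
        ((le_abs_self _).trans (hM w hw))
  have := key.div (GammaSeq_tendsto_Gamma s) hne
  refine (this.congr' ?_)
  filter_upwards [eventually_ne_atTop 0] with n hn
  rw [← (logDeriv_GammaSeq hs hn).2]
  rfl

theorem ne_neg_natCast_of_im_pos {s : ℂ} (hs : 0 < s.im) (m : ℕ) : s ≠ -m := fun h => by
  simp [h] at hs

theorem digamma_add_nat {s : ℂ} (hs : 0 < s.im) (n : ℕ) :
    digamma (s + n) = digamma s + ∑ j ∈ range n, 1 / (s + j) := by
  induction n with
  | zero => simp
  | succ n ih =>
    rw [Finset.sum_range_succ, ← add_assoc, ← ih, Nat.cast_succ, ← add_assoc,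
      digamma_apply_add_one _ (ne_neg_natCast_of_im_pos (by simpa using hs)), one_div]

open Filter Topology in
theorem tendsto_digamma_sub_log_add_nat {s : ℂ} (hs : 0 < s.im) :
    Tendsto (fun n : ℕ => digamma (s + n) - log (s + n)) atTop (𝓝 0) := by
  wlog hre : 0 < s.re generalizing s
  · obtain ⟨m, hm⟩ := exists_nat_gt (-s.re)
    have := this (s := s + m) (by simpa using hs) (by simp; linarith)
    rw [← tendsto_add_atTop_iff_nat m]
    refine this.congr fun n => ?_
    push_cast
    rw [add_assoc, add_comm (m : ℂ)]
  · rw [← tendsto_add_atTop_iff_nat 1]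
    have h1 := (tendsto_log_sub_sum_digamma hre).const_sub (digamma s)
    have h2 : Tendsto (fun n : ℕ => log ((s + 1) * (n : ℂ)⁻¹ + 1)) atTop (𝓝 0) := by
      have h3 : Tendsto (fun n : ℕ => (s + 1) * (n : ℂ)⁻¹ + 1) atTop (𝓝 1) := by
        simpa using (tendsto_inv_atTop_nhds_zero_nat (𝕜 := ℂ)).const_mul (s + 1) |>.add_const 1
      simpa using h3.clog (by simp)
    have h4 := h1.sub h2
    rw [sub_self, sub_zero] at h4
    refine h4.congr' ?_
    filter_upwards [eventually_gt_atTop 0] with n hn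
    have hn' : (0 : ℝ) < n := by exact_mod_cast hn
    have hnc : (n : ℂ) ≠ 0 := by exact_mod_cast hn.ne'
    have hne : (s + 1) * (n : ℂ)⁻¹ + 1 ≠ 0 := fun h => by
      have h5 := congrArg im h
      rw [← ofReal_natCast, ← ofReal_inv] at h5
      simp at h5
      rcases h5 with h5 | h5
      · linarith
      · omega
    have h6 : s + ((n + 1 : ℕ) : ℂ) = ((n : ℝ) : ℂ) * ((s + 1) * (n : ℂ)⁻¹ + 1) := by
      push_cast
      field_simp
      ring
    rw [digamma_add_nat hs, h6, log_ofReal_mul hn' hne]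
    ring

theorem norm_digamma_sub_log_succ_sub_le {s : ℂ} (hs : 0 < s.im) (h2 : 2 ≤ ‖s‖) :
    ‖(digamma (s + 1) - log (s + 1)) - (digamma s - log s)‖ ≤ 1 / ‖s‖ ^ 2 := by
  have hs0 : s ≠ 0 := fun h => by simp [h] at hs
  have hz : ‖s⁻¹‖ ≤ 1 / 2 := by
    rw [norm_inv, ← one_div]; gcongr
  have hre : 0 < (1 + s⁻¹).re := by
    have := (abs_le.1 ((abs_re_le_norm s⁻¹).trans hz)).1
    simp at this ⊢; linarith
  have him : (1 + s⁻¹).im < 0 := by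
    have : 0 < normSq s := normSq_pos.2 hs0
    simp [inv_im]
    rw [neg_div]
    have := div_pos hs this
    linarith
  have hne : 1 + s⁻¹ ≠ 0 := fun h => by simp [h] at hre
  have hlog : log (s + 1) = log s + log (1 + s⁻¹) := by
    rw [← log_mul hs0 hne]
    · congr 1; field_simp
    · have ha := arg_nonneg_iff.2 hs.le
      have hb := arg_le_pi s
      have hc := arg_neg_iff.2 him
      have hd := (abs_lt.1 (abs_arg_lt_pi_div_two_iff.2 (Or.inl hre))).1
      constructor <;> linarith [Real.pi_pos]
  rw [digamma_apply_add_one _ (ne_neg_natCast_of_im_pos hs), hlog]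
  have h1 := norm_log_one_add_sub_self_le (lt_of_le_of_lt hz (by norm_num))
  have h3 : (1 - ‖s⁻¹‖)⁻¹ ≤ 2 := by
    rw [inv_le_comm₀ (by linarith) (by norm_num)]; linarith
  calc _ = ‖log (1 + s⁻¹) - s⁻¹‖ := by rw [← norm_neg]; congr 1; ring
    _ ≤ ‖s⁻¹‖ ^ 2 * 2 / 2 := h1.trans (by gcongr)
    _ = 1 / ‖s‖ ^ 2 := by rw [norm_inv]; field_simp

open Filter Topology in
theorem norm_digamma_sub_log_le {s : ℂ} {B : ℝ} (hB : 1 ≤ B) (hre : |s.re| ≤ B)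
    (him : 2 * B ≤ s.im) : ‖digamma s - log s‖ ≤ 8 / s.im := by
  have hpos : 0 < s.im := by linarith
  set t := s.im with ht
  have hstep : ∀ n : ℕ, ‖(digamma (s + n) - log (s + n)) - (digamma s - log s)‖ ≤
      4 * (1 / (t - 1) - 1 / (t + n - 1)) := by
    intro n
    induction n with
    | zero => simp
    | succ n ih =>
      have h1 := norm_digamma_sub_log_succ_sub_le (s := s + n) (by simpa using hpos) (by
        have := (le_abs_self _).trans (abs_im_le_norm (s + n))
        simp at this; linarith)
      have hn : (0 : ℝ) ≤ n := by positivity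
      have hsq : (t + n) ^ 2 / 4 ≤ ‖s + n‖ ^ 2 := by
        rw [Complex.sq_norm, normSq_apply]
        simp only [add_re, natCast_re, add_im, natCast_im, add_zero, ← ht]
        nlinarith [abs_le.1 hre, sq_nonneg (2 * s.re + n), sq_nonneg (t - n),
          sq_nonneg (s.re + B), mul_nonneg (by linarith [(abs_le.1 hre).1] : 0 ≤ B + s.re)
            (by linarith [(abs_le.1 hre).2] : 0 ≤ B - s.re)]
      have h2 : 1 / ‖s + n‖ ^ 2 ≤ 4 * (1 / (t + n - 1) - 1 / (t + (n + 1 : ℕ) - 1)) := by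
        have h3 : 1 / ‖s + n‖ ^ 2 ≤ 4 / (t + n) ^ 2 := by
          rw [div_le_div_iff₀ (by nlinarith) (by nlinarith)]; linarith
        refine h3.trans ?_
        have e : 4 * (1 / (t + n - 1) - 1 / (t + (n + 1 : ℕ) - 1)) =
            4 / ((t + n - 1) * (t + n)) := by
          push_cast
          have : t + n - 1 ≠ 0 := by linarith
          have : t + n ≠ 0 := by linarith
          have : t + (n + 1) - 1 ≠ 0 := by linarith
          field_simp
          ring
        rw [e]
        apply div_le_div_of_nonneg_left (by norm_num) (by nlinarith) (by nlinarith)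
      have e2 : s + ((n + 1 : ℕ) : ℂ) = s + n + 1 := by push_cast; ring
      rw [e2]
      calc _ = ‖((digamma (s + n + 1) - log (s + n + 1)) - (digamma (s + n) - log (s + n))) +
            ((digamma (s + n) - log (s + n)) - (digamma s - log s))‖ := by congr 1; ring
        _ ≤ _ := norm_add_le _ _
        _ ≤ _ := by linarith
  have hlim := ((tendsto_digamma_sub_log_add_nat hpos).sub_const (digamma s - log s)).norm
  rw [zero_sub, norm_neg] at hlim
  refine le_of_tendsto hlim (Eventually.of_forall fun n => (hstep n).trans ?_)
  have hn : (0 : ℝ) ≤ n := by positivity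
  have h1 : 0 ≤ 1 / (t + n - 1) := by apply div_nonneg <;> linarith
  have h2 : 1 / (t - 1) ≤ 2 / t := by
    rw [div_le_div_iff₀ (by linarith) (by linarith)]; linarith
  have : 8 / t = 4 * (2 / t) := by ring
  linarith

theorem norm_log_sub_le {s : ℂ} {B : ℝ} (hB : 1 ≤ B) (hre : |s.re| ≤ B)
    (him : 2 * B ≤ s.im) : ‖log s - (Real.log s.im + Real.pi / 2 * I)‖ ≤ 2 * B / s.im := by
  have hpos : 0 < s.im := by linarith
  have htc : (s.im : ℂ) ≠ 0 := by exact_mod_cast hpos.ne'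
  set z : ℂ := -I * (s.re / s.im : ℝ) with hz
  have hzn : ‖z‖ ≤ B / s.im := by
    simp only [hz, norm_mul, norm_neg, norm_I, one_mul, norm_real, Real.norm_eq_abs, abs_div,
      abs_of_pos hpos]
    gcongr
  have hz2 : ‖z‖ ≤ 1 / 2 := hzn.trans (by rw [div_le_div_iff₀ hpos (by norm_num)]; linarith)
  have hs : s = (s.im : ℂ) * (I * (1 + z)) := by
    rw [hz]
    push_cast
    field_simp
    apply Complex.ext <;> simp
  have hre1 : 0 < (1 + z).re := by
    have := (abs_le.1 ((abs_re_le_norm z).trans hz2)).1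
    simp only [add_re, one_re]; linarith
  have hne : 1 + z ≠ 0 := fun h => by simp [h] at hre1
  have h1 : log s = Real.log s.im + (Real.pi / 2 * I + log (1 + z)) := by
    conv_lhs => rw [hs]
    rw [log_ofReal_mul hpos (mul_ne_zero I_ne_zero hne), log_mul I_ne_zero hne, log_I]
    rw [arg_I]
    have := abs_lt.1 (abs_arg_lt_pi_div_two_iff.2 (Or.inl hre1))
    constructor <;> linarith [Real.pi_pos]
  rw [h1]
  have h2 := norm_log_one_add_half_le_self hz2
  calc _ = ‖log (1 + z)‖ := by congr 1; ring
    _ ≤ 3 / 2 * ‖z‖ := h2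
    _ ≤ 2 * (B / s.im) := by
      have := norm_nonneg z
      nlinarith
    _ = _ := by ring

theorem norm_tan_sub_I_le {z : ℂ} (hz : 1 ≤ z.im) : ‖tan z - I‖ ≤ 2 / z.im := by
  have hE : exp (z * I) ≠ 0 := exp_ne_zero _
  set q := exp (2 * (z * I)) with hq
  have hqn : ‖q‖ = Real.exp (-(2 * z.im)) := by
    rw [hq, norm_exp]; congr 1; simp
  have h1 : 1 + 2 * z.im ≤ Real.exp (2 * z.im) := by
    linarith [Real.add_one_le_exp (2 * z.im)]
  have hqb : ‖q‖ ≤ 1 / (1 + 2 * z.im) := by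
    rw [hqn, Real.exp_neg, ← one_div]
    gcongr
  have hq3 : ‖q‖ ≤ 1 / 3 := hqb.trans (by
    apply one_div_le_one_div_of_le <;> linarith)
  have hq1 : 2 / 3 ≤ ‖1 + q‖ := by
    have := norm_sub_norm_le 1 (-q)
    rw [norm_neg, sub_neg_eq_add, norm_one] at this
    linarith
  have hne : 1 + q ≠ 0 := fun h => by rw [h] at hq1; norm_num at hq1
  have hm : exp (-z * I) = exp (z * I) / q := by
    rw [hq, ← exp_sub]; congr 1; ring
  have hqE : q = exp (z * I) * exp (z * I) := by rw [hq, ← exp_add]; congr 1; ring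
  have hq0 : q ≠ 0 := exp_ne_zero _
  have hid : tan z - I = -2 * I * q / (1 + q) := by
    rw [tan, sin, cos, hm]
    have e1 : exp (z * I) + exp (z * I) / q = exp (z * I) * (1 + q) / q := by field_simp; ring
    rw [e1, eq_div_iff hne]
    have hne' : q + 1 ≠ 0 := by rwa [add_comm]
    field_simp
    ring
  rw [hid, norm_div, norm_mul, norm_mul, norm_neg, norm_I, mul_one]
  simp only [norm_ofNat]
  rw [div_le_div_iff₀ (by linarith) (by linarith)]
  have : ‖q‖ * z.im ≤ 1 / 2 := by
    have : ‖q‖ * z.im ≤ 1 / (1 + 2 * z.im) * z.im := by gcongr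
    refine this.trans ?_
    rw [div_mul_eq_mul_div, div_le_div_iff₀ (by linarith) (by norm_num)]; linarith
  nlinarith

theorem cos_ne_zero_of_im_pos {s : ℂ} (hs : 0 < s.im) : cos s ≠ 0 := fun h => by
  obtain ⟨k, hk⟩ := cos_eq_zero_iff.1 h
  have := congrArg im hk
  have e : ((2 * (k : ℂ) + 1) * Real.pi / 2) = (((2 * (k : ℝ) + 1) * Real.pi / 2 : ℝ) : ℂ) := by
    push_cast; ring
  rw [e, ofReal_im] at this
  linarith

theorem pi_mul_div_two_im (s : ℂ) : (Real.pi * s / 2).im = Real.pi * s.im / 2 := by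
  have : (Real.pi * s / 2) = ((Real.pi / 2 : ℝ) : ℂ) * s := by push_cast; ring
  rw [this, im_ofReal_mul]; ring

theorem pi_mul_div_two_im_pos {s : ℂ} (hs : 0 < s.im) : 0 < (Real.pi * s / 2).im := by
  rw [pi_mul_div_two_im]
  have := Real.pi_pos
  positivity

theorem isOpen_im_pos : IsOpen {s : ℂ | 0 < s.im} := isOpen_lt continuous_const continuous_im

theorem differentiableAt_Gamma_of_im_pos {s : ℂ} (hs : 0 < s.im) : DifferentiableAt ℂ Gamma s :=
  differentiableAt_Gamma s (ne_neg_natCast_of_im_pos hs)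

theorem differentiableAt_omega {s : ℂ} (hs : 0 < s.im) : DifferentiableAt ℂ omega s := by
  have hG : DifferentiableOn ℂ Gamma {s : ℂ | 0 < s.im} := fun w hw =>
    (differentiableAt_Gamma_of_im_pos hw).differentiableWithinAt
  have hG' := (hG.deriv isOpen_im_pos).differentiableAt (isOpen_im_pos.mem_nhds hs)
  have h1 := hG'.div (differentiableAt_Gamma_of_im_pos hs)
    (Gamma_ne_zero (ne_neg_natCast_of_im_pos hs))
  have h2 : DifferentiableAt ℂ (fun s : ℂ => tan (Real.pi * s / 2)) s := by
    have := (differentiableAt_tan (x := Real.pi * s / 2)).2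
      (cos_ne_zero_of_im_pos (pi_mul_div_two_im_pos hs))
    exact DifferentiableAt.fun_comp' s this (by fun_prop)
  exact (h1.const_add _).sub (h2.const_mul _)

theorem exists_norm_omega_sub_le {B : ℝ} (hB : 1 ≤ B) : ∃ C > 0, ∀ s : ℂ, |s.re| ≤ B →
    2 * B ≤ s.im → ‖omega s - (Real.log s.im + Real.log (2 * Real.pi) : ℝ)‖ ≤ C / s.im := by
  refine ⟨8 + 2 * B + 2, by linarith, fun s hre him => ?_⟩
  have hpos : 0 < s.im := by linarith
  have h1 := norm_digamma_sub_log_le hB hre him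
  have h2 := norm_log_sub_le hB hre him
  have hI := pi_mul_div_two_im s
  have hpi := Real.pi_gt_three
  have h3 := norm_tan_sub_I_le (z := Real.pi * s / 2) (by rw [hI]; nlinarith)
  rw [hI] at h3
  have h4 : ‖(Real.pi / 2 : ℂ) * (tan (Real.pi * s / 2) - I)‖ ≤ 2 / s.im := by
    rw [norm_mul]
    have : ‖(Real.pi / 2 : ℂ)‖ = Real.pi / 2 := by
      rw [norm_div, norm_real, Real.norm_eq_abs, abs_of_pos Real.pi_pos]; norm_num
    rw [this]
    refine (mul_le_mul_of_nonneg_left h3 (by positivity)).trans (le_of_eq ?_)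
    field_simp
    
  calc _ = ‖(digamma s - log s) + (log s - (Real.log s.im + Real.pi / 2 * I))
          - (Real.pi / 2 : ℂ) * (tan (Real.pi * s / 2) - I)‖ := by
        congr 1
        rw [omega, digamma, logDeriv_apply]
        push_cast
        ring
    _ ≤ _ := (norm_sub_le _ _).trans (add_le_add_left (norm_add_le _ _) _)
    _ ≤ 8 / s.im + 2 * B / s.im + 2 / s.im := by gcongr
    _ = _ := by ring

/-- The factor relating `ζ (1 - s)` to `ζ s`. -/
noncomputable def zetaFactor (s : ℂ) : ℂ :=
  2 * (2 * Real.pi) ^ (-s) * Gamma s * cos (Real.pi * s / 2)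

theorem riemannZeta_one_sub_eq {s : ℂ} (hs : 0 < s.im) :
    riemannZeta (1 - s) = zetaFactor s * riemannZeta s :=
  riemannZeta_one_sub (ne_neg_natCast_of_im_pos hs) fun h => by simp [h] at hs

theorem zetaFactor_ne_zero {s : ℂ} (hs : 0 < s.im) : zetaFactor s ≠ 0 := by
  have h2pi : (2 * Real.pi : ℂ) ≠ 0 := by simp [Real.pi_ne_zero]
  refine mul_ne_zero (mul_ne_zero (mul_ne_zero two_ne_zero ?_)
    (Gamma_ne_zero (ne_neg_natCast_of_im_pos hs)))
    (cos_ne_zero_of_im_pos (pi_mul_div_two_im_pos hs))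
  simp [cpow_eq_zero_iff, h2pi]

theorem hasDerivAt_zetaFactor {s : ℂ} (hs : 0 < s.im) :
    HasDerivAt zetaFactor ((omega s - 2 * Real.log (2 * Real.pi)) * zetaFactor s) s := by
  have h2pi : (2 * Real.pi : ℂ) ≠ 0 := by simp [Real.pi_ne_zero]
  have hG := (differentiableAt_Gamma_of_im_pos hs).hasDerivAt
  have h1 : HasDerivAt (fun s : ℂ => (2 * Real.pi : ℂ) ^ (-s))
      ((2 * Real.pi : ℂ) ^ (-s) * log (2 * Real.pi) * (-1)) s :=
    (hasDerivAt_id s).neg.const_cpow (Or.inl h2pi)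
  have h2 : HasDerivAt (fun s : ℂ => cos (Real.pi * s / 2))
      (-sin (Real.pi * s / 2) * (Real.pi / 2)) s := by
    have : HasDerivAt (fun s : ℂ => Real.pi * s / 2) (Real.pi / 2) s := by
      simpa using ((hasDerivAt_id s).const_mul (Real.pi : ℂ)).div_const 2
    exact (hasDerivAt_cos _).comp s this
  have h3 := ((h1.const_mul 2).mul hG).mul h2
  refine h3.congr_deriv ?_
  have hc := cos_ne_zero_of_im_pos (pi_mul_div_two_im_pos hs)
  have hg := Gamma_ne_zero (ne_neg_natCast_of_im_pos hs)
  have hl : log (2 * Real.pi) = (Real.log (2 * Real.pi) : ℂ) := by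
    rw [ofReal_log (by positivity)]; push_cast; rfl
  simp only [zetaFactor, omega, tan, hl, Pi.mul_apply]
  field_simp
  ring

theorem exists_norm_inv_zetaFactor_le {B : ℝ} (hB : 1 ≤ B) : ∃ C > 0, ∃ A : ℕ, ∀ s : ℂ,
    |s.re| ≤ B → 2 * B ≤ s.im → ‖(zetaFactor s)⁻¹‖ ≤ C * s.im ^ A := by
  obtain ⟨K, hK, hω⟩ := exists_norm_omega_sub_le hB
  have hcont : ContinuousOn (fun s => (zetaFactor s)⁻¹) (Set.Icc (-B) B ×ℂ {2 * B}) := by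
    intro s hs
    have him : 0 < s.im := by
      have := (mem_reProdIm.1 hs).2
      simp at this; linarith
    exact ((hasDerivAt_zetaFactor him).continuousAt.inv₀
      (zetaFactor_ne_zero him)).continuousWithinAt
  obtain ⟨M, hM⟩ := (isCompact_Icc.reProdIm isCompact_singleton).exists_bound_of_continuousOn hcont
  have hnat := Nat.le_ceil K
  refine ⟨|M| + 1, by positivity, ⌈K⌉₊, fun s hre him => ?_⟩
  have hpos : 0 < s.im := by linarith
  set σ := s.re
  have hderiv : ∀ t : ℝ, 2 * B ≤ t → HasDerivAt
      (fun t : ℝ => Real.log (‖zetaFactor (σ + t * I)‖ ^ 2) + 2 * K * Real.log t)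
      (2 * -(omega (σ + t * I)).im + 2 * K * t⁻¹) t := by
    intro t ht
    have hz : 0 < ((σ : ℂ) + t * I).im := by simp; linarith
    have hne := zetaFactor_ne_zero hz
    have h1 : HasDerivAt (fun t : ℝ => zetaFactor (σ + t * I))
        ((omega (σ + t * I) - 2 * Real.log (2 * Real.pi)) * zetaFactor (σ + t * I) * I) t := by
      have h0 : HasDerivAt (fun t : ℂ => (σ : ℂ) + t * I) I (t : ℂ) := by
        simpa using ((hasDerivAt_id (t : ℂ)).mul_const I).const_add (σ : ℂ)
      exact ((hasDerivAt_zetaFactor hz).comp (t : ℂ) h0).comp_ofReal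
    have hn : 0 < ‖zetaFactor (σ + t * I)‖ := norm_pos_iff.2 hne
    have h2 := (h1.norm_sq.log (by positivity)).add
      ((Real.hasDerivAt_log (by linarith : t ≠ 0)).const_mul (2 * K))
    refine h2.congr_deriv ?_
    congr 1
    rw [div_eq_iff (by positivity), Complex.inner, mul_right_comm _ (zetaFactor _) I, mul_assoc,
      mul_conj, normSq_eq_norm_sq]
    rw [re_mul_ofReal]
    have : ((omega (σ + t * I) - 2 * Real.log (2 * Real.pi)) * I).re =
        -(omega (σ + t * I)).im := by
      simp
    rw [this]; ring
  have hmono : MonotoneOn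
      (fun t : ℝ => Real.log (‖zetaFactor (σ + t * I)‖ ^ 2) + 2 * K * Real.log t)
      (Set.Ici (2 * B)) := by
    refine monotoneOn_of_deriv_nonneg (convex_Ici _)
      (fun t ht => (hderiv t ht).continuousAt.continuousWithinAt)
      (fun t ht => (hderiv t (interior_subset ht)).differentiableAt.differentiableWithinAt)
      fun t ht => ?_
    have ht' : 2 * B ≤ t := interior_subset ht
    rw [(hderiv t ht').deriv]
    have h1 := hω (σ + t * I) (by simpa using hre) (by simpa using ht')
    have h2 := (abs_le.1 ((abs_im_le_norm _).trans h1)).2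
    rw [sub_im, ofReal_im, sub_zero] at h2
    simp only [add_im, ofReal_im, mul_im, ofReal_re, I_im, mul_one, I_re, mul_zero, zero_add,
      add_zero, div_eq_mul_inv] at h2
    linarith
  have hm := hmono Set.self_mem_Ici him him
  have hs : (σ : ℂ) + s.im * I = s := re_add_im s
  simp only [hs] at hm
  have h0 : 0 < ‖zetaFactor (σ + (2 * B : ℝ) * I)‖ :=
    norm_pos_iff.2 (zetaFactor_ne_zero (by simp; linarith))
  have h1 : 0 < ‖zetaFactor s‖ := norm_pos_iff.2 (zetaFactor_ne_zero hpos)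
  have hM' : ‖zetaFactor (σ + (2 * B : ℝ) * I)‖⁻¹ ≤ |M| := by
    rw [← norm_inv]
    refine (hM _ ?_).trans (le_abs_self _)
    rw [mem_reProdIm]
    simpa using abs_le.1 hre
  rw [Real.log_pow, Real.log_pow] at hm
  have hlogB : 0 ≤ Real.log (2 * B) := Real.log_nonneg (by linarith)
  have hlogt : 0 ≤ Real.log s.im := Real.log_nonneg (by linarith)
  have hfin : Real.log (‖zetaFactor s‖⁻¹) ≤
      Real.log (‖zetaFactor (σ + (2 * B : ℝ) * I)‖⁻¹ * s.im ^ ⌈K⌉₊) := by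
    rw [Real.log_mul (by positivity) (by positivity), Real.log_inv, Real.log_inv, Real.log_pow]
    push_cast at hm ⊢
    nlinarith [mul_nonneg hK.le hlogB]
  rw [norm_inv]
  refine ((Real.log_le_log_iff (by positivity) (by positivity)).1 hfin).trans ?_
  gcongr
  linarith

/-- The difference between `a ^ (-s)` and `∫ x in a..a+1, x ^ (-s)`, for `a = n + 1`. -/
noncomputable def zetaTerm (n : ℕ) (s : ℂ) : ℂ :=
  ((n : ℂ) + 1) ^ (-s) - (((n : ℂ) + 2) ^ (1 - s) - ((n : ℂ) + 1) ^ (1 - s)) / (1 - s)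

theorem norm_zetaTerm_le (n : ℕ) {s : ℂ} (hs : 0 ≤ s.re) (h1 : s ≠ 1) :
    ‖zetaTerm n s‖ ≤ ‖s‖ * ((n : ℝ) + 1) ^ (-(s.re + 1)) := by
  have hd : 1 - s ≠ 0 := sub_ne_zero.2 (Ne.symm h1)
  set a : ℝ := (n : ℝ) + 1 with ha
  have ha0 : 0 < a := by positivity
  have hx0 : ∀ x ∈ Set.Icc a (a + 1), 0 < x := fun x hx => ha0.trans_le hx.1
  have key : ∀ x ∈ Set.Icc a (a + 1), ‖(a : ℂ) ^ (-s) - (x : ℂ) ^ (-s)‖ ≤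
      ‖s‖ * a ^ (-(s.re + 1)) := by
    intro x hx
    have := (convex_Icc a (a + 1)).norm_image_sub_le_of_norm_hasDerivWithin_le (𝕜 := ℝ)
      (f := fun y : ℝ => (y : ℂ) ^ (-s)) (f' := fun y : ℝ => -s * (y : ℂ) ^ (-s - 1))
      (C := ‖s‖ * a ^ (-(s.re + 1))) (x := x) (y := a) (fun y hy => ?_) (fun y hy => ?_) hx
      (by simp)
    · refine this.trans ?_
      have : ‖a - x‖ ≤ 1 := by
        rw [Real.norm_eq_abs, abs_le]; constructor <;> linarith [hx.1, hx.2]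
      exact mul_le_of_le_one_right (by positivity) this
    · have h := (hasDerivAt_id (y : ℂ)).cpow_const (c := -s) (Or.inl (by simpa using hx0 y hy))
      simpa using h.comp_ofReal.hasDerivWithinAt
    · rw [norm_mul, norm_neg, norm_cpow_eq_rpow_re_of_pos (hx0 y hy)]
      have : (-s - 1).re = -(s.re + 1) := by simp; ring
      rw [this]
      exact mul_le_mul_of_nonneg_left
        (Real.rpow_le_rpow_of_nonpos ha0 hy.1 (by linarith)) (norm_nonneg _)
  have := (convex_Icc a (a + 1)).norm_image_sub_le_of_norm_hasDerivWithin_le (𝕜 := ℝ)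
    (f := fun x : ℝ => (a : ℂ) ^ (-s) * x - (x : ℂ) ^ (1 - s) / (1 - s))
    (f' := fun x : ℝ => (a : ℂ) ^ (-s) - (x : ℂ) ^ (-s))
    (C := ‖s‖ * a ^ (-(s.re + 1))) (x := a) (y := a + 1) (fun y hy => ?_) key
    (by simp) (by simp)
  · have e : zetaTerm n s = (fun x : ℝ => (a : ℂ) ^ (-s) * x - (x : ℂ) ^ (1 - s) / (1 - s)) (a + 1)
        - (fun x : ℝ => (a : ℂ) ^ (-s) * x - (x : ℂ) ^ (1 - s) / (1 - s)) a := by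
      simp only [zetaTerm, ha]; push_cast; rw [show (n : ℂ) + 1 + 1 = n + 2 by ring]; ring
    rw [e]; simpa using this
  · have h := ((hasDerivAt_id (y : ℂ)).cpow_const (c := 1 - s)
      (Or.inl (by simpa using hx0 y hy))).div_const (1 - s)
    have h2 := ((hasDerivAt_id (y : ℂ)).const_mul ((a : ℂ) ^ (-s))).sub h
    have h3 := h2.comp_ofReal.hasDerivWithinAt (s := Set.Icc a (a + 1))
    refine h3.congr_deriv ?_
    rw [mul_one, mul_one, mul_div_cancel_left₀ _ hd, show 1 - s - 1 = -s by ring, id]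

theorem differentiableAt_zetaTerm (n : ℕ) {s : ℂ} (h1 : s ≠ 1) :
    DifferentiableAt ℂ (zetaTerm n) s := by
  have hd : 1 - s ≠ 0 := sub_ne_zero.2 (Ne.symm h1)
  have h : (n : ℂ) + 1 ≠ 0 := Nat.cast_add_one_ne_zero n
  have h' : (n : ℂ) + 2 ≠ 0 := by exact_mod_cast (by omega : n + 2 ≠ 0)
  unfold zetaTerm
  fun_prop (disch := simp [*])

theorem summable_add_one_rpow {p : ℝ} (hp : 1 < p) :
    Summable fun n : ℕ => ((n : ℝ) + 1) ^ (-p) := by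
  have := (summable_nat_add_iff 1).2 (Real.summable_nat_rpow.2 (by linarith : -p < -1))
  simpa using this

theorem tsum_zetaTerm_of_one_lt_re {s : ℂ} (hs : 1 < s.re) :
    ∑' n, zetaTerm n s = riemannZeta s + 1 / (1 - s) := by
  have h1 : s ≠ 1 := fun h => by simp [h] at hs
  have hsum : Summable fun n => zetaTerm n s :=
    Summable.of_norm_bounded ((summable_add_one_rpow (p := s.re + 1) (by linarith)).mul_left ‖s‖)
      fun n => norm_zetaTerm_le n (by linarith) h1
  refine tendsto_nhds_unique hsum.hasSum.tendsto_sum_nat ?_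
  have e : ∀ N : ℕ, ∑ n ∈ range N, zetaTerm n s =
      ∑ n ∈ range N, 1 / ((n : ℂ) + 1) ^ s - (((N : ℂ) + 1) ^ (1 - s) - 1) / (1 - s) := by
    intro N
    induction N with
    | zero => simp
    | succ N ih =>
      rw [sum_range_succ, ih, sum_range_succ, zetaTerm, cpow_neg]
      push_cast
      rw [show (N : ℂ) + 1 + 1 = N + 2 by ring]
      ring
  simp_rw [e]
  have hz : Summable fun n : ℕ => 1 / ((n : ℂ) + 1) ^ s := by
    have := (summable_nat_add_iff 1).2 (Complex.summable_one_div_nat_cpow.2 hs)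
    simpa using this
  have h2 := hz.hasSum.tendsto_sum_nat
  rw [← zeta_eq_tsum_one_div_nat_add_one_cpow hs] at h2
  have h3 : Filter.Tendsto (fun N : ℕ => ((N : ℂ) + 1) ^ (1 - s)) Filter.atTop (nhds 0) := by
    rw [tendsto_zero_iff_norm_tendsto_zero]
    have : ∀ N : ℕ, ‖((N : ℂ) + 1) ^ (1 - s)‖ = ((N : ℝ) + 1) ^ (-(s.re - 1)) := fun N => by
      have := norm_cpow_eq_rpow_re_of_pos (x := (N : ℝ) + 1) (by positivity) (1 - s)
      push_cast at this
      rw [this]; simp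
    simp_rw [this]
    have := (tendsto_rpow_neg_atTop (y := s.re - 1) (by linarith)).comp
      (Filter.tendsto_atTop_add_const_right _ (1 : ℝ) tendsto_natCast_atTop_atTop)
    exact this
  have := h2.sub ((h3.sub_const 1).div_const (1 - s))
  convert this using 2
  ring

theorem tsum_zetaTerm {s : ℂ} (hs : 1 / 4 < s.re) (ht : 0 < s.im) :
    ∑' n, zetaTerm n s = riemannZeta s + 1 / (1 - s) := by
  set R := ‖s‖ + 3 with hR
  set U : Set ℂ := {z | 1 / 4 < z.re} ∩ {z | 0 < z.im} ∩ Metric.ball 0 R with hU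
  have ho : IsOpen U := ((isOpen_lt continuous_const continuous_re).inter
    (isOpen_lt continuous_const continuous_im)).inter Metric.isOpen_ball
  have hconv : Convex ℝ U := ((convex_halfSpace_re_gt _).inter (convex_halfSpace_im_gt _)).inter
    (convex_ball _ _)
  have hne : ∀ z ∈ U, z ≠ 1 := fun z hz h => by
    have := hz.1.2; simp [h] at this
  have hd1 : DifferentiableOn ℂ (fun z => ∑' n, zetaTerm n z) U := by
    refine differentiableOn_tsum_of_summable_norm
      ((summable_add_one_rpow (p := 5 / 4) (by norm_num)).mul_left R)
      (fun n z hz => (differentiableAt_zetaTerm n (hne z hz)).differentiableWithinAt) ho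
      fun n z hz => (norm_zetaTerm_le n (by have := hz.1.1; simp at this; linarith)
        (hne z hz)).trans ?_
    have hzR : ‖z‖ ≤ R := by simpa using (Metric.mem_ball.1 hz.2).le
    have : (1 : ℝ) / 4 < z.re := hz.1.1
    gcongr
    · simp
    · linarith
  have hd2 : DifferentiableOn ℂ (fun z => riemannZeta z + 1 / (1 - z)) U := fun z hz => by
    have h1 := hne z hz
    have := differentiableAt_riemannZeta h1
    have hd : 1 - z ≠ 0 := sub_ne_zero.2 (Ne.symm h1)
    exact (this.add (by fun_prop (disch := exact hd))).differentiableWithinAt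
  have hp : (2 + I : ℂ) ∈ U := by
    refine ⟨⟨by simp; norm_num, by simp⟩, ?_⟩
    have : ‖(2 + I : ℂ)‖ ≤ 2 + 1 := (norm_add_le _ _).trans (by simp)
    have hs0 : 0 < ‖s‖ := norm_pos_iff.2 fun h => by simp [h] at ht
    simp only [mem_ball_zero_iff]; linarith
  refine (hd1.analyticOnNhd ho).eqOn_of_preconnected_of_eventuallyEq (hd2.analyticOnNhd ho)
    hconv.isPreconnected hp ?_ ⟨⟨hs, ht⟩, by simp [hR]⟩
  have : {z : ℂ | 1 < z.re} ∈ nhds (2 + I) :=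
    (isOpen_lt continuous_const continuous_re).mem_nhds (by simp)
  filter_upwards [this] with z hz using tsum_zetaTerm_of_one_lt_re hz

theorem exists_norm_riemannZeta_le_of_half_le_re : ∃ C > 0, ∀ s : ℂ, 1 / 2 ≤ s.re → 1 ≤ s.im →
    ‖riemannZeta s‖ ≤ C * ‖s‖ := by
  set S := ∑' n : ℕ, ((n : ℝ) + 1) ^ (-(3 / 2) : ℝ) with hS
  have hS0 : 0 ≤ S := tsum_nonneg fun n => by positivity
  refine ⟨S + 1, by linarith, fun s hs ht => ?_⟩
  have h1 : s ≠ 1 := fun h => by simp [h] at ht; linarith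
  have hns : 1 ≤ ‖s‖ := ht.trans ((le_abs_self _).trans (abs_im_le_norm s))
  have h2 : 1 ≤ ‖1 - s‖ := by
    refine le_trans ?_ (abs_im_le_norm _)
    simp only [sub_im, one_im, zero_sub, abs_neg]
    exact ht.trans (le_abs_self _)
  have e : riemannZeta s = ∑' n, zetaTerm n s - 1 / (1 - s) := by
    rw [tsum_zetaTerm (by linarith) (by linarith)]; ring
  have hb : ‖∑' n, zetaTerm n s‖ ≤ ‖s‖ * S := by
    rw [hS, ← tsum_mul_left]
    refine tsum_of_norm_bounded
      (((summable_add_one_rpow (p := 3 / 2) (by norm_num)).mul_left ‖s‖).hasSum) fun n => ?_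
    refine (norm_zetaTerm_le n (by linarith) h1).trans ?_
    gcongr
    · simp
    · linarith
  rw [e]
  refine (norm_sub_le _ _).trans ?_
  have : ‖1 / (1 - s)‖ ≤ 1 := by
    rw [norm_div, norm_one]; exact (div_le_one (by linarith)).2 h2
  nlinarith

theorem norm_riemannZeta_conj (s : ℂ) : ‖riemannZeta ((starRingEnd ℂ) s)‖ = ‖riemannZeta s‖ := by
  rw [riemannZeta_conj]; simp

theorem exists_norm_riemannZeta_le {B : ℝ} (hB : 1 ≤ B) : ∃ C > 0, ∃ A : ℕ, ∀ s : ℂ,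
    |s.re| ≤ B → 2 * B ≤ s.im → ‖riemannZeta s‖ ≤ C * s.im ^ A := by
  obtain ⟨C₁, hC₁, h₁⟩ := exists_norm_riemannZeta_le_of_half_le_re
  obtain ⟨C₂, hC₂, A, h₂⟩ := exists_norm_inv_zetaFactor_le hB
  refine ⟨2 * C₁ + C₂ * (3 * C₁), by positivity, A + 1, fun s hre him => ?_⟩
  have hre' := abs_le.1 hre
  have him1 : 1 ≤ s.im := by linarith
  have hnorm : ‖s‖ ≤ 2 * s.im := by
    refine (norm_le_abs_re_add_abs_im s).trans ?_
    rw [abs_of_pos (by linarith : 0 < s.im)]; linarith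
  have hpow : s.im ≤ s.im ^ (A + 1) := by
    simpa using pow_le_pow_right₀ him1 (by omega : 1 ≤ A + 1)
  rcases le_total (1 / 2) s.re with h | h
  · calc ‖riemannZeta s‖ ≤ C₁ * ‖s‖ := h₁ s h him1
      _ ≤ C₁ * (2 * s.im ^ (A + 1)) := by gcongr; linarith
      _ ≤ _ := by nlinarith [mul_pos hC₂ hC₁, pow_pos (by linarith : 0 < s.im) (A + 1)]
  · have hpos : 0 < s.im := by linarith
    have e : riemannZeta s = (zetaFactor s)⁻¹ * riemannZeta (1 - s) := by
      rw [riemannZeta_one_sub_eq hpos, inv_mul_cancel_left₀ (zetaFactor_ne_zero hpos)]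
    have h3 : ‖riemannZeta (1 - s)‖ ≤ 3 * C₁ * s.im := by
      rw [← norm_riemannZeta_conj]
      refine (h₁ _ (by simp; linarith) (by simpa using him1)).trans ?_
      have : ‖(starRingEnd ℂ) (1 - s)‖ ≤ 3 * s.im := by
        rw [Complex.norm_conj]
        refine (norm_sub_le _ _).trans ?_
        rw [norm_one]; linarith
      nlinarith
    rw [e, norm_mul]
    calc _ ≤ (C₂ * s.im ^ A) * (3 * C₁ * s.im) := by gcongr; exact h₂ s hre him
      _ = C₂ * (3 * C₁) * s.im ^ (A + 1) := by ring
      _ ≤ _ := by gcongr; linarith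

/-- The filter of points of the closed vertical strip `u ≤ re s ≤ v` going up to infinity. -/
def stripFilter (u v : ℝ) : Filter ℂ :=
  Filter.comap im Filter.atTop ⊓ Filter.principal {s | u ≤ s.re ∧ s.re ≤ v}

theorem eventually_stripFilter {u v : ℝ} {p : ℂ → Prop} : (∀ᶠ s in stripFilter u v, p s) ↔
    ∃ t₀, ∀ s : ℂ, u ≤ s.re → s.re ≤ v → t₀ ≤ s.im → p s := by
  rw [stripFilter, Filter.eventually_inf_principal,
    (Filter.atTop_basis.comap im).eventually_iff]
  constructor
  · rintro ⟨t, -, h⟩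
    exact ⟨t, fun s h1 h2 h3 => h (Set.mem_preimage.2 h3) ⟨h1, h2⟩⟩
  · rintro ⟨t, h⟩
    exact ⟨t, trivial, fun s h3 h' => h s h'.1 h'.2 h3⟩

theorem eventually_stripFilter_le_im (u v t : ℝ) : ∀ᶠ s in stripFilter u v, t ≤ s.im :=
  eventually_stripFilter.2 ⟨t, fun _ _ _ h => h⟩

theorem stripFilter_mono {u v u' v' : ℝ} (hu : u ≤ u') (hv : v' ≤ v) :
    stripFilter u' v' ≤ stripFilter u v :=
  inf_le_inf_left _ (Filter.principal_mono.2 fun _ h => ⟨hu.trans h.1, h.2.trans hv⟩)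

theorem differentiableAt_Zk (k : ℕ) {s : ℂ} (hs : 0 < s.im) : DifferentiableAt ℂ (Zk k) s := by
  suffices H : DifferentiableOn ℂ (Zk k) {s : ℂ | 0 < s.im} from
    H.differentiableAt (isOpen_im_pos.mem_nhds hs)
  clear hs s
  induction k with
  | zero =>
    intro s hs
    exact (differentiableAt_riemannZeta fun h => by
      simp [h] at hs).differentiableWithinAt
  | succ k ih =>
    intro s hs
    have h1 := (ih.deriv isOpen_im_pos).differentiableAt (isOpen_im_pos.mem_nhds hs)
    have h2 := ih.differentiableAt (isOpen_im_pos.mem_nhds hs)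
    exact (h1.sub (((differentiableAt_const (1 / 2 : ℂ)).mul
      (differentiableAt_omega hs)).mul h2)).differentiableWithinAt

theorem stripFilter_eventually_forall_ball {u v u' v' δ : ℝ} (hu : u + δ ≤ u') (hv : v' + δ ≤ v)
    {p : ℂ → Prop} (h : ∀ᶠ s in stripFilter u v, p s) :
    ∀ᶠ s in stripFilter u' v', ∀ z, ‖z - s‖ ≤ δ → p z := by
  obtain ⟨t, ht⟩ := eventually_stripFilter.1 h
  refine eventually_stripFilter.2 ⟨t + δ, fun s h1 h2 h3 z hz => ht z ?_ ?_ ?_⟩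
  · have := (abs_le.1 ((abs_re_le_norm _).trans hz)).1; simp at this; linarith
  · have := (abs_le.1 ((abs_re_le_norm _).trans hz)).2; simp at this; linarith
  · have := (abs_le.1 ((abs_im_le_norm _).trans hz)).1; simp at this; linarith

theorem norm_deriv_le_of_forall_closedBall {f : ℂ → ℂ} {s : ℂ} {δ C : ℝ} (hδ : 0 < δ)
    (hd : ∀ z, ‖z - s‖ ≤ δ → DifferentiableAt ℂ f z) (hC : ∀ z, ‖z - s‖ ≤ δ → ‖f z‖ ≤ C) :
    ‖deriv f s‖ ≤ C / δ := by
  refine norm_deriv_le_of_forall_mem_sphere_norm_le hδ ?_ fun z hz =>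
    hC z (mem_sphere_iff_norm.1 hz).le
  refine DifferentiableOn.diffContOnCl fun z hz => ?_
  rw [closure_ball s hδ.ne'] at hz
  exact (hd z (mem_closedBall_iff_norm.1 hz)).differentiableWithinAt

theorem eventually_norm_deriv_le {u v u' v' δ C : ℝ} (hδ : 0 < δ) (hu : u + δ ≤ u')
    (hv : v' + δ ≤ v) {f : ℂ → ℂ} (hd : ∀ᶠ s in stripFilter u v, DifferentiableAt ℂ f s)
    (hC : ∀ᶠ s in stripFilter u v, ‖f s‖ ≤ C) :
    ∀ᶠ s in stripFilter u' v', ‖deriv f s‖ ≤ C / δ := by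
  filter_upwards [stripFilter_eventually_forall_ball hu hv hd,
    stripFilter_eventually_forall_ball hu hv hC] with s h1 h2
  exact norm_deriv_le_of_forall_closedBall hδ h1 h2

theorem eventually_norm_omega_le (B : ℝ) (hB : 1 ≤ B) :
    ∀ᶠ s in stripFilter (-B) B, ‖omega s‖ ≤ s.im := by
  obtain ⟨C, hC, h⟩ := exists_norm_omega_sub_le hB
  have h1 : ∀ᶠ t : ℝ in Filter.atTop, Real.log t ≤ t / 2 := by
    have := Real.isLittleO_log_id_atTop.bound (c := 1 / 2) (by norm_num)
    filter_upwards [this, Filter.eventually_ge_atTop 1] with t h1 h2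
    simp only [id, Real.norm_eq_abs, abs_of_pos (by linarith : (0 : ℝ) < t)] at h1
    linarith [le_abs_self (Real.log t)]
  obtain ⟨t₀, ht₀⟩ := Filter.eventually_atTop.1 h1
  refine eventually_stripFilter.2 ⟨max (max t₀ (2 * B)) (2 * (C + |Real.log (2 * Real.pi)|)),
    fun s h1 h2 h3 => ?_⟩
  have h4 : t₀ ≤ s.im := (le_max_left _ _).trans ((le_max_left _ _).trans h3)
  have h5 : 2 * B ≤ s.im := (le_max_right _ _).trans ((le_max_left _ _).trans h3)
  have h6 := (le_max_right _ _).trans h3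
  have h7 : 1 ≤ s.im := by linarith
  have h8 := h s (abs_le.2 ⟨h1, h2⟩) h5
  have h9 : C / s.im ≤ C := div_le_self hC.le h7
  have h10 := ht₀ _ h4
  have h11 := Real.log_nonneg h7
  have h12 : ‖omega s‖ ≤ C / s.im + |Real.log s.im + Real.log (2 * Real.pi)| := by
    have := norm_le_norm_sub_add (omega s) ((Real.log s.im + Real.log (2 * Real.pi) : ℝ) : ℂ)
    rw [norm_real, Real.norm_eq_abs] at this
    exact this.trans (by gcongr)
  have h13 := abs_add_le (Real.log s.im) (Real.log (2 * Real.pi))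
  rw [abs_of_nonneg h11] at h13
  linarith

theorem exists_eventually_norm_Zk_le (k : ℕ) : ∀ B : ℝ, 1 ≤ B → ∃ A : ℕ,
    ∀ᶠ s in stripFilter (-B) B, ‖Zk k s‖ ≤ s.im ^ A := by
  induction k with
  | zero =>
    intro B hB
    obtain ⟨C, hC, A, h⟩ := exists_norm_riemannZeta_le hB
    refine ⟨A + 1, eventually_stripFilter.2 ⟨max C (2 * B), fun s h1 h2 h3 => ?_⟩⟩
    have h4 : C ≤ s.im := (le_max_left _ _).trans h3
    have h5 : 2 * B ≤ s.im := (le_max_right _ _).trans h3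
    refine (h s (abs_le.2 ⟨h1, h2⟩) h5).trans ?_
    rw [pow_succ']
    have : 0 ≤ s.im := by linarith
    gcongr
  | succ k ih =>
    intro B hB
    obtain ⟨A, hA⟩ := ih (B + 1) (by linarith)
    refine ⟨2 * A + 2, ?_⟩
    have hball := stripFilter_eventually_forall_ball (u := -(B + 1)) (v := B + 1) (u' := -B)
      (v' := B) (δ := 1) (by linarith) (by linarith) (hA.and (eventually_stripFilter_le_im _ _ 1))
    filter_upwards [hball, eventually_norm_omega_le B hB,
      eventually_stripFilter_le_im _ _ 2] with s h1 h2 h3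
    have hd : ‖deriv (Zk k) s‖ ≤ s.im ^ (2 * A) := by
      have := norm_deriv_le_of_forall_closedBall (f := Zk k) (s := s) (δ := 1)
        (C := s.im ^ (2 * A)) one_pos
        (fun z hz => differentiableAt_Zk k (by linarith [(h1 z hz).2])) fun z hz => ?_
      · simpa using this
      · refine (h1 z hz).1.trans ?_
        rw [pow_mul]
        have h4 := (h1 z hz).2
        have h5 := (abs_le.1 ((abs_im_le_norm _).trans hz)).2
        simp only [sub_im] at h5
        gcongr
        nlinarith
    have h0 : ‖Zk k s‖ ≤ s.im ^ (2 * A) := by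
      refine (h1 s (by simp)).1.trans ?_
      exact pow_le_pow_right₀ (by linarith) (by omega)
    have hp : 0 < s.im ^ (2 * A) := by positivity
    calc ‖Zk (k + 1) s‖ ≤ ‖deriv (Zk k) s‖ + 1 / 2 * ‖omega s‖ * ‖Zk k s‖ := by
          refine (norm_sub_le _ _).trans ?_
          rw [norm_mul, norm_mul]; simp
      _ ≤ s.im ^ (2 * A) + 1 / 2 * s.im * s.im ^ (2 * A) := by gcongr
      _ ≤ s.im ^ (2 * A + 2) := by
          have : 1 + 1 / 2 * s.im ≤ s.im ^ 2 := by nlinarith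
          rw [pow_add]; nlinarith

theorem tendsto_leading_coeff {u v : ℝ} {a g : ℂ → ℂ} {Y : ℕ → ℂ → ℂ}
    (ha : ∀ᶠ s in stripFilter u v, DifferentiableAt ℂ a s)
    (hY : ∀ k, ∀ᶠ s in stripFilter u v, DifferentiableAt ℂ (Y k) s)
    (ha0 : ∀ᶠ s in stripFilter u v, a s ≠ 0)
    (hb : Filter.Tendsto (fun s => (a s)⁻¹) (stripFilter u v) (nhds 0))
    {C : ℝ} (hC : ∀ᶠ s in stripFilter u v, ‖g s‖ ≤ C)
    (h0 : ∀ᶠ s in stripFilter u v, Y 0 s = g s)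
    (hsucc : ∀ k, ∀ᶠ s in stripFilter u v, Y (k + 1) s = deriv (Y k) s + a s * Y k s)
    (k : ℕ) : ∀ u' v', u < u' → v' < v →
      Filter.Tendsto (fun s => Y k s / a s ^ k - g s) (stripFilter u' v') (nhds 0) := by
  induction k with
  | zero =>
    intro u' v' hu hv
    refine Filter.Tendsto.congr' ?_ tendsto_const_nhds
    filter_upwards [stripFilter_mono hu.le hv.le h0] with s hs
    simp [hs]
  | succ k ih =>
    intro u' v' hu hv
    set δ := min ((u' - u) / 2) ((v - v') / 2) with hδ
    have hδ0 : 0 < δ := lt_min (by linarith) (by linarith)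
    have hδ1 : δ ≤ (u' - u) / 2 := min_le_left _ _
    have hδ2 : δ ≤ (v - v') / 2 := min_le_right _ _
    have hu1 : u < u + δ := by linarith
    have hv1 : v - δ < v := by linarith
    have hmono1 := stripFilter_mono hu1.le hv1.le
    have hmono := stripFilter_mono hu.le hv.le
    have ih1 := ih (u + δ) (v - δ) hu1 hv1
    set h : ℂ → ℂ := fun s => Y k s / a s ^ k with hh
    have hbd : ∀ᶠ s in stripFilter (u + δ) (v - δ), ‖h s‖ ≤ C + 1 := by
      have := ih1.norm.eventually (ge_mem_nhds (by simp : ‖(0 : ℂ)‖ < 1))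
      filter_upwards [this, hmono1 hC] with s h1 h2
      have := norm_le_norm_sub_add (h s) (g s)
      linarith
    have hdh : ∀ᶠ s in stripFilter (u + δ) (v - δ), DifferentiableAt ℂ h s := by
      filter_upwards [hmono1 ha, hmono1 (hY k), hmono1 ha0] with s h1 h2 h3
      exact h2.div (h1.pow k) (pow_ne_zero _ h3)
    have hdh' := eventually_norm_deriv_le (u' := u') (v' := v') hδ0 (by linarith) (by linarith)
      hdh hbd
    have hbd' : ∀ᶠ s in stripFilter u' v', ‖h s‖ ≤ C + 1 :=
      stripFilter_mono (by linarith) (by linarith) hbd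
    have hb' : Filter.Tendsto (fun s => deriv (fun s => (a s)⁻¹) s) (stripFilter u' v')
        (nhds 0) := by
      rw [tendsto_zero_iff_norm_tendsto_zero, Metric.tendsto_nhds]
      intro ε hε
      have h1 : ∀ᶠ s in stripFilter u v, ‖(a s)⁻¹‖ ≤ ε / 2 * δ := by
        have h1 : ‖(0 : ℂ)‖ < ε / 2 * δ := by simp; positivity
        exact hb.norm.eventually (ge_mem_nhds h1)
      have h2 : ∀ᶠ s in stripFilter u v, DifferentiableAt ℂ (fun s => (a s)⁻¹) s := by
        filter_upwards [ha, ha0] with s h1 h2 using h1.inv h2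
      filter_upwards [eventually_norm_deriv_le (u' := u') (v' := v') hδ0 (by linarith)
        (by linarith) h2 h1] with s hs
      rw [mul_div_cancel_right₀ _ hδ0.ne'] at hs
      simp only [dist_zero_right, norm_norm]
      linarith
    have t1 : Filter.Tendsto (fun s => (a s)⁻¹ * deriv h s) (stripFilter u' v') (nhds 0) := by
      refine Filter.Tendsto.zero_mul_isBoundedUnder_le (hb.mono_left hmono) ?_
      exact ⟨(C + 1) / δ, Filter.eventually_map.2 hdh'⟩
    have t2 : Filter.Tendsto (fun s => deriv (fun s => (a s)⁻¹) s * (k * h s)) (stripFilter u' v')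
        (nhds 0) := by
      refine hb'.zero_mul_isBoundedUnder_le ?_
      refine ⟨k * (C + 1), Filter.eventually_map.2 ?_⟩
      filter_upwards [hbd'] with s hs
      simp only [Function.comp, norm_mul, norm_natCast]
      gcongr
    have t3 := (t1.sub t2).add (ih u' v' hu hv)
    simp only [sub_zero, add_zero] at t3
    refine t3.congr' ?_
    filter_upwards [hmono ha, hmono (hY k), hmono ha0, hmono (hsucc k)] with s h1 h2 h3 h4
    have e1 : deriv (fun s => (a s)⁻¹) s = -deriv a s / a s ^ 2 :=
      (h1.hasDerivAt.inv h3).deriv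
    have e2 : deriv h s = (deriv (Y k) s * a s ^ k - Y k s * (k * a s ^ (k - 1) * deriv a s)) /
        (a s ^ k) ^ 2 :=
      (h2.hasDerivAt.div (h1.hasDerivAt.pow k) (pow_ne_zero _ h3)).deriv
    rw [h4, e1, e2]
    simp only [hh]
    rcases k with _ | k
    · field_simp; simp; ring
    · rw [Nat.add_sub_cancel]
      field_simp
      ring

theorem norm_riemannZeta_le_of_le_re {s : ℂ} {c : ℝ} (hc : 1 < c) (hs : c ≤ s.re) :
    ‖riemannZeta s‖ ≤ ∑' n : ℕ, ((n : ℝ) + 1) ^ (-c) := by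
  rw [zeta_eq_tsum_one_div_nat_add_one_cpow (by linarith)]
  refine tsum_of_norm_bounded (summable_add_one_rpow hc).hasSum fun n => ?_
  have := norm_cpow_eq_rpow_re_of_pos (x := (n : ℝ) + 1) (by positivity) s
  push_cast at this
  rw [norm_div, norm_one, this, one_div, ← Real.rpow_neg (by positivity)]
  gcongr
  simp

theorem norm_riemannZeta_sub_one_le {s : ℂ} (hs : 2 ≤ s.re) :
    ‖riemannZeta s - 1‖ ≤ 13 / 20 := by
  have h1 : Summable fun n : ℕ => 1 / ((n : ℂ) + 1) ^ s := by
    have := (summable_nat_add_iff 1).2 (Complex.summable_one_div_nat_cpow.2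
      (by linarith : 1 < s.re))
    simpa using this
  have h2 : HasSum (fun n : ℕ => 1 / ((n : ℝ) + 2) ^ 2) (Real.pi ^ 2 / 6 - 1) := by
    have := (hasSum_nat_add_iff' 2).2 hasSum_zeta_two
    simpa [sum_range_succ] using this
  rw [zeta_eq_tsum_one_div_nat_add_one_cpow (by linarith), h1.tsum_eq_zero_add]
  simp only [Nat.cast_zero, zero_add, one_cpow, div_one, add_sub_cancel_left]
  refine (tsum_of_norm_bounded h2 fun n => ?_).trans ?_
  · have := norm_cpow_eq_rpow_re_of_pos (x := (n : ℝ) + 2) (by positivity) s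
    push_cast at this
    push_cast
    rw [norm_div, norm_one, add_assoc, one_add_one_eq_two, this]
    gcongr
    rw [← Real.rpow_natCast]
    exact Real.rpow_le_rpow_of_exponent_le (by linarith [(n.cast_nonneg : (0 : ℝ) ≤ n)])
      (by simpa using hs)
  · nlinarith [Real.pi_lt_d4, Real.pi_pos]

theorem eventually_le_re_omega (B M : ℝ) : ∀ᶠ s in stripFilter (-B) B, M ≤ (omega s).re := by
  obtain ⟨C, hC, h⟩ := exists_norm_omega_sub_le (le_max_right B 1)
  have h1 := Real.tendsto_log_atTop.eventually_ge_atTop (M + C - Real.log (2 * Real.pi))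
  obtain ⟨t₀, ht₀⟩ := Filter.eventually_atTop.1 h1
  refine eventually_stripFilter.2 ⟨max t₀ (2 * max B 1), fun s h1 h2 h3 => ?_⟩
  have h4 : t₀ ≤ s.im := (le_max_left _ _).trans h3
  have h5 : 2 * max B 1 ≤ s.im := (le_max_right _ _).trans h3
  have hB := le_max_left B 1
  have h8 := h s (abs_le.2 ⟨by linarith, by linarith⟩) h5
  have h7 : 1 ≤ s.im := by linarith [le_max_right B 1]
  have h9 : C / s.im ≤ C := div_le_self hC.le h7
  have h10 := ht₀ _ h4
  have h11 := (abs_le.1 ((abs_re_le_norm _).trans h8)).1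
  rw [sub_re, ofReal_re] at h11
  linarith

/-- The dominating coefficient for `Z_k` on the right of the critical strip. -/
noncomputable def rightCoeff (s : ℂ) : ℂ := -(1 / 2) * omega s

/-- The dominating coefficient for `zetaFactor * Z_k` on the left of the critical strip. -/
noncomputable def leftCoeff (s : ℂ) : ℂ :=
  ((2 * Real.log (2 * Real.pi) : ℝ) : ℂ) - (3 / 2) * omega s

theorem eventually_rightCoeff_re_le (B M : ℝ) :
    ∀ᶠ s in stripFilter (-B) B, (rightCoeff s).re ≤ -M := by
  filter_upwards [eventually_le_re_omega B (2 * M)] with s hs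
  have : (rightCoeff s).re = -(1 / 2) * (omega s).re := by
    have : rightCoeff s = ((-(1 / 2) : ℝ) : ℂ) * omega s := by simp [rightCoeff]
    rw [this, re_ofReal_mul]
  rw [this]; linarith

theorem eventually_leftCoeff_re_le (B M : ℝ) :
    ∀ᶠ s in stripFilter (-B) B, (leftCoeff s).re ≤ -M := by
  filter_upwards [eventually_le_re_omega B (2 / 3 * (M + 2 * Real.log (2 * Real.pi)))] with s hs
  have : (leftCoeff s).re = 2 * Real.log (2 * Real.pi) - (3 / 2) * (omega s).re := by
    have : leftCoeff s = ((2 * Real.log (2 * Real.pi) : ℝ) : ℂ) - ((3 / 2 : ℝ) : ℂ) * omega s := by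
      simp [leftCoeff]
    rw [this, sub_re, re_ofReal_mul, ofReal_re]
  rw [this]; linarith

theorem tendsto_inv_of_eventually_re_le {l : Filter ℂ} {a : ℂ → ℂ}
    (h : ∀ M : ℝ, ∀ᶠ s in l, (a s).re ≤ -M) : Filter.Tendsto (fun s => (a s)⁻¹) l (nhds 0) := by
  refine Filter.tendsto_inv₀_cobounded.comp (tendsto_norm_atTop_iff_cobounded.1 ?_)
  refine Filter.tendsto_atTop.2 fun M => ?_
  filter_upwards [h M] with s hs
  have := neg_abs_le (a s).re
  linarith [abs_re_le_norm (a s)]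

theorem differentiableAt_rightCoeff {s : ℂ} (hs : 0 < s.im) : DifferentiableAt ℂ rightCoeff s :=
  (differentiableAt_omega hs).const_mul _

theorem differentiableAt_leftCoeff {s : ℂ} (hs : 0 < s.im) : DifferentiableAt ℂ leftCoeff s :=
  ((differentiableAt_omega hs).const_mul _).const_sub _

theorem eventually_norm_Zk_div_sub_one_le (k : ℕ) :
    ∀ᶠ s in stripFilter 2 2, ‖Zk k s / rightCoeff s ^ k - 1‖ ≤ 9 / 10 := by
  have him := eventually_stripFilter_le_im (5 / 4) 3 1
  have hsub : stripFilter (5 / 4) 3 ≤ stripFilter (-3) 3 :=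
    stripFilter_mono (by norm_num) (by norm_num)
  have hre : ∀ᶠ s in stripFilter (5 / 4) 3, (5 / 4 : ℝ) ≤ s.re :=
    eventually_stripFilter.2 ⟨0, fun s h _ _ => h⟩
  have hre2 : ∀ᶠ s in stripFilter 2 2, (2 : ℝ) ≤ s.re :=
    eventually_stripFilter.2 ⟨0, fun s h _ _ => h⟩
  have key := tendsto_leading_coeff (u := 5 / 4) (v := 3) (a := rightCoeff) (g := riemannZeta)
    (Y := Zk) (C := ∑' n : ℕ, ((n : ℝ) + 1) ^ (-(5 / 4) : ℝ))
    (him.mono fun s h => differentiableAt_rightCoeff (by linarith))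
    (fun k => him.mono fun s h => differentiableAt_Zk k (by linarith))
    (Filter.Eventually.mono (hsub (eventually_rightCoeff_re_le 3 1)) fun s h h0 => by
      rw [h0, zero_re] at h; linarith)
    (tendsto_inv_of_eventually_re_le fun M => hsub (eventually_rightCoeff_re_le 3 M))
    (hre.mono fun s h => norm_riemannZeta_le_of_le_re (by norm_num) h)
    (Filter.Eventually.of_forall fun s => rfl)
    (fun k => Filter.Eventually.of_forall fun s => by simp only [Zk, rightCoeff]; ring)
    k 2 2 (by norm_num) (by norm_num)
  filter_upwards [key.norm.eventually (ge_mem_nhds (by norm_num : ‖(0 : ℂ)‖ < 1 / 4)), hre2]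
    with s h1 h2
  have h3 := norm_riemannZeta_sub_one_le h2
  have h4 := norm_sub_le_norm_sub_add_norm_sub (Zk k s / rightCoeff s ^ k) (riemannZeta s) 1
  linarith

theorem eventually_norm_zetaFactor_mul_Zk_div_sub_one_le (k : ℕ) :
    ∀ᶠ s in stripFilter (-1) (-1), ‖zetaFactor s * Zk k s / leftCoeff s ^ k - 1‖ ≤ 9 / 10 := by
  have him := eventually_stripFilter_le_im (-2) (-(1 / 4)) 1
  have hsub : stripFilter (-2) (-(1 / 4)) ≤ stripFilter (-2) 2 :=
    stripFilter_mono (by norm_num) (by norm_num)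
  have hre : ∀ᶠ s in stripFilter (-2) (-(1 / 4)), s.re ≤ (-(1 / 4) : ℝ) :=
    eventually_stripFilter.2 ⟨0, fun s _ h _ => h⟩
  have hre2 : ∀ᶠ s in stripFilter (-1) (-1), s.re ≤ (-1 : ℝ) :=
    eventually_stripFilter.2 ⟨0, fun s _ h _ => h⟩
  have key := tendsto_leading_coeff (u := -2) (v := -(1 / 4)) (a := leftCoeff)
    (g := fun s => riemannZeta (1 - s))
    (Y := fun k s => zetaFactor s * Zk k s) (C := ∑' n : ℕ, ((n : ℝ) + 1) ^ (-(5 / 4) : ℝ))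
    (him.mono fun s h => differentiableAt_leftCoeff (by linarith))
    (fun k => him.mono fun s h => (hasDerivAt_zetaFactor (by linarith)).differentiableAt.mul
      (differentiableAt_Zk k (by linarith)))
    (Filter.Eventually.mono (hsub (eventually_leftCoeff_re_le 2 1)) fun s h h0 => by
      rw [h0, zero_re] at h; linarith)
    (tendsto_inv_of_eventually_re_le fun M => hsub (eventually_leftCoeff_re_le 2 M))
    (hre.mono fun s h => norm_riemannZeta_le_of_le_re (by norm_num) (by
      simp only [sub_re, one_re]; linarith))
    (him.mono fun s h => (riemannZeta_one_sub_eq (by linarith)).symm)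
    (fun k => him.mono fun s h => by
      have hd := ((hasDerivAt_zetaFactor (by linarith : 0 < s.im)).mul
        (differentiableAt_Zk k (by linarith)).hasDerivAt).deriv
      change deriv (fun s => zetaFactor s * Zk k s) s = _ at hd
      rw [hd]
      simp only [Zk, leftCoeff]
      push_cast
      ring)
    k (-1) (-1) (by norm_num) (by norm_num)
  filter_upwards [key.norm.eventually (ge_mem_nhds (by norm_num : ‖(0 : ℂ)‖ < 1 / 4)), hre2]
    with s h1 h2
  have h3 := norm_riemannZeta_sub_one_le (s := 1 - s) (by simp only [sub_re, one_re]; linarith)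
  have h4 := norm_sub_le_norm_sub_add_norm_sub (zetaFactor s * Zk k s / leftCoeff s ^ k)
    (riemannZeta (1 - s)) 1
  linarith

theorem integral_div_eq_log_sub_log {F F' : ℝ → ℂ} {a b : ℝ} {c : ℂ}
    (hF : ∀ t ∈ Set.uIcc a b, HasDerivAt F (F' t) t) (hF' : ContinuousOn F' (Set.uIcc a b))
    (hre : ∀ t ∈ Set.uIcc a b, 0 < (c * F t).re) :
    ∫ t in a..b, F' t / F t = log (c * F b) - log (c * F a) := by
  have hne : ∀ t ∈ Set.uIcc a b, c * F t ≠ 0 := fun t ht h => by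
    have := hre t ht; rw [h] at this; simp at this
  refine intervalIntegral.integral_eq_sub_of_hasDerivAt (f := fun t => log (c * F t))
    (fun t ht => ?_) ?_
  · have := ((hF t ht).const_mul c).clog_real (Or.inl (hre t ht))
    rwa [mul_div_mul_left _ _ (left_ne_zero_of_mul (hne t ht))] at this
  · exact (hF'.div (fun t ht => (hF t ht).continuousAt.continuousWithinAt)
      fun t ht => right_ne_zero_of_mul (hne t ht)).intervalIntegrable

theorem abs_im_integral_div_le_pi {F F' : ℝ → ℂ} {a b : ℝ} (c : ℂ)
    (hF : ∀ t ∈ Set.uIcc a b, HasDerivAt F (F' t) t) (hF' : ContinuousOn F' (Set.uIcc a b))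
    (hre : ∀ t ∈ Set.uIcc a b, 0 < (c * F t).re) :
    |(∫ t in a..b, F' t / F t).im| ≤ Real.pi := by
  rw [integral_div_eq_log_sub_log hF hF' hre, sub_im, log_im, log_im]
  have h1 := abs_le.1 (abs_arg_le_pi_div_two_iff.2 (hre b Set.right_mem_uIcc).le)
  have h2 := abs_le.1 (abs_arg_le_pi_div_two_iff.2 (hre a Set.left_mem_uIcc).le)
  rw [abs_le]
  constructor <;> linarith [h1.1, h1.2, h2.1, h2.2]

theorem hasDerivAt_ofReal_mul_add_sub (v p : ℂ) (t : ℝ) :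
    HasDerivAt (fun t : ℝ => p + t * v) v t := by
  simpa using (((hasDerivAt_id (t : ℂ)).mul_const v).const_add p).comp_ofReal

/-- The integral of `F` over the boundary of `[a, b] × [c, d]`, counterclockwise. -/
noncomputable def rectIntegral (F : ℂ → ℂ) (a b c d : ℝ) : ℂ :=
  (∫ x : ℝ in a..b, F (x + c * I)) - (∫ x : ℝ in a..b, F (x + d * I)) +
    I * (∫ y : ℝ in c..d, F (b + y * I)) - I * (∫ y : ℝ in c..d, F (a + y * I))

theorem log_I_mul {w : ℂ} (hr : 0 < w.re) :
    log (I * w) = log w + (Real.pi / 2 : ℝ) * I := by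
  have hw : w ≠ 0 := fun h => by simp [h] at hr
  rw [log_mul_eq_add_log_iff I_ne_zero hw |>.2, log_I]
  · push_cast; ring
  · rw [arg_I]
    have h1 := abs_lt.1 (abs_arg_lt_pi_div_two_iff.2 (Or.inl hr))
    constructor <;> linarith [h1.1, h1.2, Real.pi_pos]

theorem rectIntegral_inv_sub {a b c d : ℝ} {ρ : ℂ} (ha : a < ρ.re) (hb : ρ.re < b)
    (hc : c < ρ.im) (hd : ρ.im < d) :
    rectIntegral (fun z => (z - ρ)⁻¹) a b c d = 2 * Real.pi * I := by
  have hor : ∀ (q : ℝ) (e : ℂ), (∀ x : ℝ, 0 < (e * (q * I - ρ + x * 1)).re) →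
      ∫ x : ℝ in a..b, ((x : ℂ) + q * I - ρ)⁻¹ =
        log (e * (b + q * I - ρ)) - log (e * (a + q * I - ρ)) := by
    intro q e h
    have := integral_div_eq_log_sub_log (a := a) (b := b) (c := e)
      (fun t _ => hasDerivAt_ofReal_mul_add_sub 1 (q * I - ρ) t) continuousOn_const
      fun t _ => h t
    simp only [mul_one, one_div] at this
    have h0 : ∀ x : ℝ, (x : ℂ) + q * I - ρ = q * I - ρ + x := fun x => by ring
    simp only [h0, this]
  have ver : ∀ (q : ℝ) (e : ℂ), (∀ y : ℝ, 0 < (e * (q - ρ + y * I)).re) →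
      I * ∫ y : ℝ in c..d, ((q : ℂ) + y * I - ρ)⁻¹ =
        log (e * (q + d * I - ρ)) - log (e * (q + c * I - ρ)) := by
    intro q e h
    have := integral_div_eq_log_sub_log (a := c) (b := d) (c := e)
      (fun t _ => hasDerivAt_ofReal_mul_add_sub I (q - ρ) t) continuousOn_const
      fun t _ => h t
    simp only [div_eq_mul_inv, intervalIntegral.integral_const_mul] at this
    have h0 : ∀ y : ℝ, (q : ℂ) + y * I - ρ = q - ρ + y * I := fun y => by ring
    simp only [h0, this]
  have e1 := log_I_mul (w := b + c * I - ρ) (by simpa using hb)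
  have e2 := log_I_mul (w := -I * (b + d * I - ρ)) (by simpa using hd)
  have e3 := log_I_mul (w := -1 * (a + d * I - ρ)) (by simpa using ha)
  have e4 := log_I_mul (w := I * (a + c * I - ρ)) (by simpa using hc)
  rw [← mul_assoc, show I * -I = 1 by simp, one_mul] at e2
  rw [← mul_assoc, show I * -1 = -I by simp] at e3
  rw [← mul_assoc, I_mul_I] at e4
  rw [rectIntegral, hor c I (fun x => by simpa using hc), hor d (-I) (fun x => by simpa using hd),
    ver b 1 (fun y => by simpa using hb), ver a (-1) (fun y => by simpa using ha)]
  rw [e1, e4, one_mul, one_mul, e2, e3]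
  push_cast
  ring

theorem zeroOrder_eq_of_analyticOrderAt_eq {f : ℂ → ℂ} {ρ : ℂ} {n : ℕ} (hf : AnalyticAt ℂ f ρ)
    (hn : analyticOrderAt f ρ = n) : zeroOrder f ρ = n := by
  have h1 := (natCast_le_analyticOrderAt_iff_iteratedDeriv_eq_zero (n := n) hf).1 hn.ge
  have h2 : iteratedDeriv n f ρ ≠ 0 := fun h => by
    have := (natCast_le_analyticOrderAt_iff_iteratedDeriv_eq_zero (n := n + 1) hf).2
      fun i hi => (Nat.lt_succ_iff_lt_or_eq.1 hi).elim (h1 i) (fun e => e ▸ h)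
    rw [hn] at this
    exact absurd (Nat.cast_le.1 this) (by omega)
  refine le_antisymm (Nat.sInf_le h2) (le_csInf ⟨n, h2⟩ fun m hm => ?_)
  by_contra hlt
  exact hm (h1 m (not_le.1 hlt))

theorem exists_eq_prod_zeros_mul {U : Set ℂ} (hU : IsOpen U) {f : ℂ → ℂ}
    (hf : DifferentiableOn ℂ f U) (S : Finset ℂ) (hS : ∀ ρ ∈ S, ρ ∈ U)
    (hord : ∀ ρ ∈ S, analyticOrderAt f ρ ≠ ⊤) :
    ∃ g : ℂ → ℂ, DifferentiableOn ℂ g U ∧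
      (∀ z ∈ U, f z = (∏ ρ ∈ S, (z - ρ) ^ zeroOrder f ρ) * g z) ∧ ∀ ρ ∈ S, g ρ ≠ 0 := by
  classical
  induction S using Finset.induction_on with
  | empty => exact ⟨f, hf, by simp, by simp⟩
  | insert ρ S hρ ih =>
    obtain ⟨g, hg, hfg, hgS⟩ := ih (fun z hz => hS z (mem_insert_of_mem hz))
      (fun z hz => hord z (mem_insert_of_mem hz))
    have hρU := hS ρ (mem_insert_self _ _)
    have hfa : AnalyticAt ℂ f ρ := hf.analyticAt (hU.mem_nhds hρU)
    have hga : AnalyticAt ℂ g ρ := hg.analyticAt (hU.mem_nhds hρU)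
    obtain ⟨n, hn⟩ := ENat.ne_top_iff_exists.1 (hord ρ (mem_insert_self _ _))
    have hz := zeroOrder_eq_of_analyticOrderAt_eq hfa hn.symm
    have hP : AnalyticAt ℂ (fun z => ∏ σ ∈ S, (z - σ) ^ zeroOrder f σ) ρ := by fun_prop
    have hP0 : ∏ σ ∈ S, (ρ - σ) ^ zeroOrder f σ ≠ 0 :=
      prod_ne_zero_iff.2 fun σ hσ => pow_ne_zero _ (sub_ne_zero.2 fun h => hρ (h ▸ hσ))
    have hgn : analyticOrderAt g ρ = n := by
      have h1 : f =ᶠ[nhds ρ] (fun z => ∏ σ ∈ S, (z - σ) ^ zeroOrder f σ) * g := by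
        filter_upwards [hU.mem_nhds hρU] with z hz using hfg z hz
      rw [hn, analyticOrderAt_congr h1, analyticOrderAt_mul hP hga,
        hP.analyticOrderAt_eq_zero.2 hP0, zero_add]
    obtain ⟨h, hh, hh0, hgh⟩ := (hga.analyticOrderAt_eq_natCast).1 hgn
    set g' : ℂ → ℂ := fun z => if z = ρ then h ρ else g z / (z - ρ) ^ n with hg'
    have hg'h : g' =ᶠ[nhds ρ] h := by
      filter_upwards [hgh] with z hz
      by_cases e : z = ρ
      · simp [hg', e]
      · have : z - ρ ≠ 0 := sub_ne_zero.2 e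
        simp only [hg', e, if_false, hz, smul_eq_mul]
        field_simp
    refine ⟨g', fun z hz => ?_, fun z hzU => ?_, fun σ hσ => ?_⟩
    · by_cases e : z = ρ
      · subst e
        exact (hh.differentiableAt.congr_of_eventuallyEq hg'h).differentiableWithinAt
      · have h1 : g' =ᶠ[nhds z] fun z => g z / (z - ρ) ^ n := by
          filter_upwards [isOpen_ne.mem_nhds e] with w hw
          simp only [hg', if_neg (show ¬ w = ρ from hw)]
        have h2 : DifferentiableAt ℂ (fun z => g z / (z - ρ) ^ n) z :=
          (hg.differentiableAt (hU.mem_nhds hz)).div (by fun_prop)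
            (pow_ne_zero _ (sub_ne_zero.2 e))
        exact (h2.congr_of_eventuallyEq h1).differentiableWithinAt
    · rw [prod_insert hρ, hz, hfg z hzU]
      by_cases e : z = ρ
      · subst e
        have := hgh.self_of_nhds
        simp only [smul_eq_mul] at this
        simp only [hg', if_true, this]; ring
      · have : z - ρ ≠ 0 := sub_ne_zero.2 e
        simp only [hg', e, if_false]
        field_simp
    · by_cases e : σ = ρ
      · simpa [hg', e] using hh0
      · have := hgS σ ((mem_insert.1 hσ).resolve_left e)
        simp only [hg', e, if_false]
        exact div_ne_zero this (pow_ne_zero _ (sub_ne_zero.2 e))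

theorem logDeriv_prod_zeros_mul {U : Set ℂ} (hU : IsOpen U) {f g : ℂ → ℂ} {S : Finset ℂ}
    {n : ℂ → ℕ} (hg : DifferentiableOn ℂ g U)
    (hfg : ∀ z ∈ U, f z = (∏ ρ ∈ S, (z - ρ) ^ n ρ) * g z) {z : ℂ} (hz : z ∈ U)
    (hfz : f z ≠ 0) (hzS : z ∉ S) :
    deriv f z / f z = ∑ ρ ∈ S, (n ρ : ℂ) * (z - ρ)⁻¹ + deriv g z / g z := by
  have hgz : g z ≠ 0 := fun h => hfz (by rw [hfg z hz, h, mul_zero])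
  have hne : ∀ ρ ∈ S, (z - ρ) ^ n ρ ≠ 0 := fun ρ hρ =>
    pow_ne_zero _ (sub_ne_zero.2 fun h => hzS (h ▸ hρ))
  have h1 : f =ᶠ[nhds z] fun z => (∏ ρ ∈ S, (z - ρ) ^ n ρ) * g z := by
    filter_upwards [hU.mem_nhds hz] with w hw using hfg w hw
  have h2 : logDeriv f z = logDeriv (fun z => (∏ ρ ∈ S, (z - ρ) ^ n ρ) * g z) z := by
    rw [logDeriv_apply, logDeriv_apply, h1.deriv_eq, h1.self_of_nhds]
  rw [← logDeriv_apply, h2, logDeriv_mul z (prod_ne_zero_iff.2 hne) hgz (by fun_prop)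
    (hg.differentiableAt (hU.mem_nhds hz)), logDeriv_prod (hf := hne) (hd := by fun_prop),
    logDeriv_apply g]
  congr 1
  refine sum_congr rfl fun ρ _ => ?_
  rw [logDeriv_fun_pow (by fun_prop)]
  simp [logDeriv_apply]

/-- The boundary of the rectangle `[a, b] × [c, d]`. -/
def rectBoundary (a b c d : ℝ) : Set ℂ :=
  {z | (a ≤ z.re ∧ z.re ≤ b ∧ c ≤ z.im ∧ z.im ≤ d) ∧
    (z.re = a ∨ z.re = b ∨ z.im = c ∨ z.im = d)}

theorem horizontal_mem_rectBoundary {a b c d : ℝ} (hab : a ≤ b) (hcd : c ≤ d)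
    {q : ℝ} (hq : q = c ∨ q = d) {x : ℝ}
    (hx : x ∈ Set.uIcc a b) : (x + q * I : ℂ) ∈ rectBoundary a b c d := by
  rw [Set.uIcc_of_le hab] at hx
  rcases hq with rfl | rfl <;> simp [rectBoundary, hx.1, hx.2, hcd]

theorem vertical_mem_rectBoundary {a b c d : ℝ} (hab : a ≤ b) (hcd : c ≤ d)
    {q : ℝ} (hq : q = a ∨ q = b) {y : ℝ}
    (hy : y ∈ Set.uIcc c d) : (q + y * I : ℂ) ∈ rectBoundary a b c d := by
  rw [Set.uIcc_of_le hcd] at hy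
  rcases hq with rfl | rfl <;> simp [rectBoundary, hy.1, hy.2, hab]

theorem rectIntegral_congr {a b c d : ℝ} (hab : a ≤ b) (hcd : c ≤ d)
    {F G : ℂ → ℂ} (h : ∀ z ∈ rectBoundary a b c d, F z = G z) :
    rectIntegral F a b c d = rectIntegral G a b c d := by
  have h1 : ∀ q : ℝ, q = c ∨ q = d →
      ∫ x : ℝ in a..b, F (x + q * I) = ∫ x : ℝ in a..b, G (x + q * I) := fun q hq =>
    intervalIntegral.integral_congr fun x hx => h _ (horizontal_mem_rectBoundary hab hcd hq hx)
  have h2 : ∀ q : ℝ, q = a ∨ q = b →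
      ∫ y : ℝ in c..d, F (q + y * I) = ∫ y : ℝ in c..d, G (q + y * I) := fun q hq =>
    intervalIntegral.integral_congr fun x hx => h _ (vertical_mem_rectBoundary hab hcd hq hx)
  rw [rectIntegral, rectIntegral, h1 c (.inl rfl), h1 d (.inr rfl), h2 a (.inl rfl),
    h2 b (.inr rfl)]

theorem rectBoundary_horizontal_intervalIntegrable {a b c d : ℝ} (hab : a ≤ b) (hcd : c ≤ d)
    {F : ℂ → ℂ}
    (hF : ContinuousOn F (rectBoundary a b c d)) {q : ℝ} (hq : q = c ∨ q = d) :
    IntervalIntegrable (fun x : ℝ => F (x + q * I)) MeasureTheory.volume a b :=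
  (hF.comp (by fun_prop) fun _ hx =>
    horizontal_mem_rectBoundary hab hcd hq hx).intervalIntegrable

theorem rectBoundary_vertical_intervalIntegrable {a b c d : ℝ} (hab : a ≤ b) (hcd : c ≤ d)
    {F : ℂ → ℂ}
    (hF : ContinuousOn F (rectBoundary a b c d)) {q : ℝ} (hq : q = a ∨ q = b) :
    IntervalIntegrable (fun y : ℝ => F (q + y * I)) MeasureTheory.volume c d :=
  (hF.comp (by fun_prop) fun _ hx =>
    vertical_mem_rectBoundary hab hcd hq hx).intervalIntegrable

theorem rectIntegral_add {a b c d : ℝ} (hab : a ≤ b) (hcd : c ≤ d)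
    {F G : ℂ → ℂ} (hF : ContinuousOn F (rectBoundary a b c d))
    (hG : ContinuousOn G (rectBoundary a b c d)) :
    rectIntegral (fun z => F z + G z) a b c d =
      rectIntegral F a b c d + rectIntegral G a b c d := by
  have hor := @rectBoundary_horizontal_intervalIntegrable a b c d hab hcd
  have ver := @rectBoundary_vertical_intervalIntegrable a b c d hab hcd
  simp only [rectIntegral]
  rw [intervalIntegral.integral_add (hor hF (.inl rfl)) (hor hG (.inl rfl)),
    intervalIntegral.integral_add (hor hF (.inr rfl)) (hor hG (.inr rfl)),
    intervalIntegral.integral_add (ver hF (.inl rfl)) (ver hG (.inl rfl)),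
    intervalIntegral.integral_add (ver hF (.inr rfl)) (ver hG (.inr rfl))]
  ring

theorem rectIntegral_sum {a b c d : ℝ} (hab : a ≤ b) (hcd : c ≤ d)
    {ι : Type*} {F : ι → ℂ → ℂ} {S : Finset ι}
    (hF : ∀ i ∈ S, ContinuousOn (F i) (rectBoundary a b c d)) :
    rectIntegral (fun z => ∑ i ∈ S, F i z) a b c d = ∑ i ∈ S, rectIntegral (F i) a b c d := by
  classical
  induction S using Finset.induction_on with
  | empty => simp [rectIntegral]
  | insert i S hi ih =>
    simp_rw [sum_insert hi]
    rw [rectIntegral_add hab hcd (hF i (mem_insert_self _ _))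
      (continuousOn_finsetSum _ fun j hj => hF j (mem_insert_of_mem hj)),
      ih fun j hj => hF j (mem_insert_of_mem hj)]

theorem rectIntegral_const_mul (e : ℂ) (F : ℂ → ℂ) (a b c d : ℝ) :
    rectIntegral (fun z => e * F z) a b c d = e * rectIntegral F a b c d := by
  simp only [rectIntegral, intervalIntegral.integral_const_mul]
  ring

theorem rectIntegral_logDeriv {U : Set ℂ} (hU : IsOpen U) {f : ℂ → ℂ}
    (hf : DifferentiableOn ℂ f U) {a b c d : ℝ} (hab : a ≤ b) (hcd : c ≤ d)
    (hUr : ∀ z : ℂ, a ≤ z.re → z.re ≤ b → c ≤ z.im → z.im ≤ d → z ∈ U) {S : Finset ℂ}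
    (hS : ∀ ρ ∈ S, a < ρ.re ∧ ρ.re < b ∧ c < ρ.im ∧ ρ.im < d)
    (hord : ∀ ρ ∈ S, analyticOrderAt f ρ ≠ ⊤)
    (hzero : ∀ z : ℂ, a ≤ z.re → z.re ≤ b → c ≤ z.im → z.im ≤ d → f z = 0 → z ∈ S) :
    rectIntegral (fun z => deriv f z / f z) a b c d =
      2 * Real.pi * I * ∑ ρ ∈ S, (zeroOrder f ρ : ℂ) := by
  obtain ⟨g, hg, hfg, hgS⟩ := exists_eq_prod_zeros_mul hU hf S
    (fun ρ hρ => hUr ρ (hS ρ hρ).1.le (hS ρ hρ).2.1.le (hS ρ hρ).2.2.1.le (hS ρ hρ).2.2.2.le) hord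
  have hg0 : ∀ z : ℂ, a ≤ z.re → z.re ≤ b → c ≤ z.im → z.im ≤ d → g z ≠ 0 := by
    intro z h1 h2 h3 h4 h
    have : f z = 0 := by rw [hfg z (hUr z h1 h2 h3 h4), h, mul_zero]
    exact hgS z (hzero z h1 h2 h3 h4 this) h
  have hbS : ∀ z ∈ rectBoundary a b c d, z ∉ S := by
    intro z hz hzS
    have := hS z hzS
    rcases hz.2 with h | h | h | h <;> rw [h] at this <;> simp at this
  have hcong : ∀ z ∈ rectBoundary a b c d, deriv f z / f z =
      (∑ ρ ∈ S, (zeroOrder f ρ : ℂ) * (z - ρ)⁻¹) + deriv g z / g z := by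
    intro z hz
    obtain ⟨h1, h2, h3, h4⟩ := hz.1
    exact logDeriv_prod_zeros_mul hU hg hfg (hUr z h1 h2 h3 h4)
      (fun h => hbS z hz (hzero z h1 h2 h3 h4 h)) (hbS z hz)
  have hgd : DifferentiableOn ℂ (fun z => deriv g z / g z)
      (Set.uIcc a b ×ℂ Set.uIcc c d) := by
    intro z hz
    rw [Set.uIcc_of_le hab, Set.uIcc_of_le hcd, mem_reProdIm] at hz
    obtain ⟨⟨h1, h2⟩, h3, h4⟩ := hz
    have hzU := hU.mem_nhds (hUr z h1 h2 h3 h4)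
    exact (((hg.deriv hU).differentiableAt hzU).div (hg.differentiableAt hzU)
      (hg0 z h1 h2 h3 h4)).differentiableWithinAt
  have hc1 : ∀ ρ ∈ S, ContinuousOn (fun z => (zeroOrder f ρ : ℂ) * (z - ρ)⁻¹)
      (rectBoundary a b c d) := fun ρ hρ =>
    continuousOn_const.mul ((continuousOn_id.sub continuousOn_const).inv₀ fun z hz =>
      sub_ne_zero.2 fun h => hbS z hz (by rw [show z = ρ from h]; exact hρ))
  have hc2 : ContinuousOn (fun z => deriv g z / g z) (rectBoundary a b c d) := by
    refine hgd.continuousOn.mono fun z hz => ?_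
    rw [Set.uIcc_of_le hab, Set.uIcc_of_le hcd, mem_reProdIm]
    exact ⟨⟨hz.1.1, hz.1.2.1⟩, hz.1.2.2⟩
  have hgint : rectIntegral (fun z => deriv g z / g z) a b c d = 0 := by
    have := integral_boundary_rect_eq_zero_of_differentiableOn (fun z => deriv g z / g z)
      (a + c * I) (b + d * I) (by simpa using hgd)
    simpa [rectIntegral] using this
  rw [rectIntegral_congr hab hcd hcong, rectIntegral_add hab hcd
    (continuousOn_finsetSum _ hc1) hc2, rectIntegral_sum hab hcd hc1, hgint, add_zero, mul_sum]
  refine sum_congr rfl fun ρ hρ => ?_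
  obtain ⟨h1, h2, h3, h4⟩ := hS ρ hρ
  rw [rectIntegral_const_mul, rectIntegral_inv_sub h1 h2 h3 h4]
  ring

theorem exists_zero_free_factor {U : Set ℂ} (hU : IsOpen U) {f : ℂ → ℂ}
    (hf : DifferentiableOn ℂ f U) {s₀ : ℂ} {r M : ℝ} (hr : 0 < r)
    (hUr : Metric.closedBall s₀ (3 * r) ⊆ U)
    (hM : ∀ z ∈ Metric.closedBall s₀ (3 * r), ‖f z‖ ≤ M) (h0 : f s₀ ≠ 0) {S : Finset ℂ}
    (hS : ∀ ρ ∈ S, ρ ∈ Metric.closedBall s₀ r) (hord : ∀ ρ ∈ S, analyticOrderAt f ρ ≠ ⊤)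
    (hzero : ∀ z ∈ Metric.closedBall s₀ r, f z = 0 → z ∈ S) :
    ∃ g : ℂ → ℂ, DifferentiableOn ℂ g U ∧
      (∀ z ∈ U, f z = (∏ ρ ∈ S, (z - ρ) ^ zeroOrder f ρ) * g z) ∧
      (∀ z ∈ Metric.closedBall s₀ r, g z ≠ 0) ∧
      2 ^ (∑ ρ ∈ S, zeroOrder f ρ) ≤ M / ‖f s₀‖ ∧
      ∀ z ∈ Metric.closedBall s₀ (3 * r), ‖g z‖ ≤ M / ‖f s₀‖ * ‖g s₀‖ := by
  have hsub : Metric.closedBall s₀ r ⊆ Metric.closedBall s₀ (3 * r) :=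
    Metric.closedBall_subset_closedBall (by linarith)
  obtain ⟨g, hg, hfg, hgS⟩ := exists_eq_prod_zeros_mul hU hf S (fun ρ hρ => hUr (hsub (hS ρ hρ))) hord
  set N := ∑ ρ ∈ S, zeroOrder f ρ with hN
  have hs₀ : s₀ ∈ Metric.closedBall s₀ (3 * r) := Metric.mem_closedBall_self (by linarith)
  have hf0 : 0 < ‖f s₀‖ := norm_pos_iff.2 h0
  have hM0 : 0 < M := hf0.trans_le (hM s₀ hs₀)
  have hbound : ∀ z ∈ Metric.closedBall s₀ (3 * r), ‖g z‖ ≤ M / (2 * r) ^ N := by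
    intro z hz
    have hcl : closure (Metric.ball s₀ (3 * r)) = Metric.closedBall s₀ (3 * r) :=
      closure_ball _ (by linarith)
    refine norm_le_of_forall_mem_frontier_norm_le (U := Metric.ball s₀ (3 * r))
      Metric.isBounded_ball (hg.mono (by rw [hcl]; exact hUr)).diffContOnCl ?_
      (by rw [hcl]; exact hz)
    intro w hw
    rw [frontier_ball _ (by linarith : 3 * r ≠ 0)] at hw
    have hwb : w ∈ Metric.closedBall s₀ (3 * r) := Metric.sphere_subset_closedBall hw
    have hP : (2 * r) ^ N ≤ ‖∏ ρ ∈ S, (w - ρ) ^ zeroOrder f ρ‖ := by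
      rw [norm_prod, hN, ← prod_pow_eq_pow_sum]
      refine prod_le_prod (fun _ _ => by positivity) fun ρ hρ => ?_
      rw [norm_pow]
      gcongr
      have h1 := mem_sphere_iff_norm.1 hw
      have h2 := mem_closedBall_iff_norm.1 (hS ρ hρ)
      have h3 := norm_sub_le_norm_sub_add_norm_sub w ρ s₀
      linarith
    have h1 := hM w hwb
    rw [hfg w (hUr hwb), norm_mul] at h1
    rw [le_div_iff₀ (by positivity), mul_comm]
    exact (mul_le_mul_of_nonneg_right hP (norm_nonneg _)).trans h1
  have hlow : ‖f s₀‖ ≤ r ^ N * ‖g s₀‖ := by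
    rw [hfg s₀ (hUr hs₀), norm_mul]
    gcongr
    rw [norm_prod, hN, ← prod_pow_eq_pow_sum]
    refine prod_le_prod (fun _ _ => by positivity) fun ρ hρ => ?_
    rw [norm_pow]
    gcongr
    rw [norm_sub_rev]
    exact mem_closedBall_iff_norm.1 (hS ρ hρ)
  have hrN : 0 < r ^ N := by positivity
  have h2N : (1 : ℝ) ≤ 2 ^ N := one_le_pow₀ (by norm_num)
  refine ⟨g, hg, hfg, fun z hz h => ?_, ?_, fun z hz => (hbound z hz).trans ?_⟩
  · exact hgS z (hzero z hz (by rw [hfg z (hUr (hsub hz)), h, mul_zero])) h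
  · have h1 := hbound s₀ hs₀
    rw [le_div_iff₀ (by positivity), mul_pow] at h1
    rw [le_div_iff₀ hf0]
    calc 2 ^ N * ‖f s₀‖ ≤ 2 ^ N * (r ^ N * ‖g s₀‖) := by gcongr
      _ = ‖g s₀‖ * (2 ^ N * r ^ N) := by ring
      _ ≤ M := h1
  · rw [div_mul_eq_mul_div, div_le_div_iff₀ (by positivity) hf0, mul_pow, mul_assoc]
    gcongr
    calc ‖f s₀‖ ≤ r ^ N * ‖g s₀‖ := hlow
      _ ≤ 2 ^ N * (r ^ N * ‖g s₀‖) := le_mul_of_one_le_left (by positivity) h2N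
      _ = ‖g s₀‖ * (2 ^ N * r ^ N) := by ring

theorem exists_log_norm_le {g : ℂ → ℂ} {s₀ : ℂ} {r Q : ℝ} (hr : 0 < r) (hQ : 1 ≤ Q)
    (hg : ∀ z ∈ Metric.ball s₀ r, DifferentiableAt ℂ g z)
    (hg0 : ∀ z ∈ Metric.ball s₀ r, g z ≠ 0)
    (hb : ∀ z ∈ Metric.ball s₀ r, ‖g z‖ ≤ Q * ‖g s₀‖) :
    ∃ L : ℂ → ℂ, (∀ z ∈ Metric.ball s₀ r, HasDerivAt L (deriv g z / g z) z) ∧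
      ∀ z ∈ Metric.ball s₀ r, ‖L z‖ ≤ 2 * (Real.log Q + 1) * ‖z - s₀‖ / (r - ‖z - s₀‖) := by
  have hs₀ : s₀ ∈ Metric.ball s₀ r := Metric.mem_ball_self hr
  have hgd : DifferentiableOn ℂ g (Metric.ball s₀ r) :=
    fun z hz => (hg z hz).differentiableWithinAt
  obtain ⟨L, hL0, hL⟩ :=
    ((hgd.deriv Metric.isOpen_ball).div hgd hg0).isExactOn_ball.with_val_at s₀ 0
  have hconst : ∀ z ∈ Metric.ball s₀ r, g z * exp (-L z) = g s₀ := by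
    intro z hz
    have hd : ∀ w ∈ Metric.ball s₀ r, HasDerivAt (fun z => g z * exp (-L z)) 0 w := by
      intro w hw
      have := ((hg w hw).hasDerivAt).mul ((hL w hw).neg.cexp)
      refine this.congr_deriv ?_
      have := hg0 w hw
      simp only [Pi.div_apply]
      field_simp
      ring
    have := (convex_ball s₀ r).is_const_of_fderivWithin_eq_zero (𝕜 := ℂ)
      (f := fun z => g z * exp (-L z))
      (fun w hw => (hd w hw).differentiableAt.differentiableWithinAt)
      (fun w hw => by
        rw [fderivWithin_of_isOpen Metric.isOpen_ball hw]
        ext; simp [(hd w hw).hasFDerivAt.fderiv]) hz hs₀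
    simpa [hL0] using this
  have hre : ∀ z ∈ Metric.ball s₀ r, (L z).re ≤ Real.log Q + 1 := by
    intro z hz
    have h1 : ‖g z‖ = Real.exp (L z).re * ‖g s₀‖ := by
      rw [← hconst z hz, norm_mul, norm_exp, neg_re, Real.exp_neg]
      field_simp
    have h2 := hb z hz
    rw [h1] at h2
    have h3 : Real.exp (L z).re ≤ Q := le_of_mul_le_mul_right h2 (norm_pos_iff.2 (hg0 _ hs₀))
    have := (Real.le_log_iff_exp_le (by linarith)).2 h3
    linarith
  refine ⟨L, hL, fun z hz => ?_⟩
  have hmem : ∀ w : ℂ, w ∈ Metric.ball (0 : ℂ) r → s₀ + w ∈ Metric.ball s₀ r := fun w hw => by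
    simpa using hw
  have := borelCaratheodory_zero (f := fun w => L (s₀ + w)) (M := Real.log Q + 1) (R := r)
    (z := z - s₀) (by linarith [Real.log_nonneg hQ])
    (fun w hw => ((hL _ (hmem w hw)).comp_const_add s₀ w).differentiableAt.differentiableWithinAt)
    (fun w hw => hre _ (hmem w hw)) hr (by simpa using mem_ball_iff_norm.1 hz) (by simpa using hL0)
  simpa using this

theorem abs_im_horizontal_integral_logDeriv_le {U : Set ℂ} (hU : IsOpen U) {f : ℂ → ℂ}
    (hf : DifferentiableOn ℂ f U) {T M : ℝ}
    (hUr : Metric.closedBall (2 + T * I) 12 ⊆ U)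
    (hM : ∀ z ∈ Metric.closedBall (2 + T * I : ℂ) 12, ‖f z‖ ≤ M) (h0 : f (2 + T * I) ≠ 0)
    {S : Finset ℂ}
    (hS : ∀ ρ ∈ S, ρ ∈ Metric.closedBall (2 + T * I : ℂ) 4 ∧ ρ.im ≠ T)
    (hord : ∀ ρ ∈ S, analyticOrderAt f ρ ≠ ⊤)
    (hzero : ∀ z ∈ Metric.closedBall (2 + T * I : ℂ) 4, f z = 0 → z ∈ S) :
    |(∫ x : ℝ in (-1 : ℝ)..2, deriv f (x + T * I) / f (x + T * I)).im| ≤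
      20 * Real.log (M / ‖f (2 + T * I)‖) + 12 := by
  obtain ⟨g, hg, hfg, hg0, hN, hgb⟩ := exists_zero_free_factor hU hf (s₀ := 2 + T * I) (r := 4)
    (by norm_num) (by norm_num; exact hUr) (by norm_num; exact hM) h0 (fun ρ hρ => (hS ρ hρ).1)
    hord hzero
  norm_num at hgb
  set Q := M / ‖f (2 + T * I)‖ with hQ
  set N := ∑ ρ ∈ S, zeroOrder f ρ with hNdef
  have hQ1 : 1 ≤ Q := le_trans (one_le_pow₀ (by norm_num)) hN
  have hsub : Metric.ball (2 + T * I : ℂ) 4 ⊆ U := fun z hz =>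
    hUr (Metric.closedBall_subset_closedBall (by norm_num) (Metric.ball_subset_closedBall hz))
  obtain ⟨L, hL, hLb⟩ := exists_log_norm_le (g := g) (s₀ := 2 + T * I) (r := 4) (Q := Q)
    (by norm_num) hQ1 (fun z hz => hg.differentiableAt (hU.mem_nhds (hsub hz)))
    (fun z hz => hg0 z (Metric.ball_subset_closedBall hz))
    (fun z hz => by
      have h1 := mem_ball_iff_norm.1 hz
      have := hgb z (by rw [dist_eq_norm]; linarith)
      exact this)
  have hnorm : ∀ x ∈ Set.uIcc (-1 : ℝ) 2, ‖(x + T * I : ℂ) - (2 + T * I)‖ ≤ 3 := by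
    intro x hx
    rw [Set.uIcc_of_le (by norm_num)] at hx
    rw [show (x + T * I : ℂ) - (2 + T * I) = ((x - 2 : ℝ) : ℂ) by push_cast; ring, norm_real,
      Real.norm_eq_abs, abs_le]
    constructor <;> linarith [hx.1, hx.2]
  have hmem : ∀ x ∈ Set.uIcc (-1 : ℝ) 2, (x + T * I : ℂ) ∈ Metric.ball (2 + T * I : ℂ) 4 :=
    fun x hx => mem_ball_iff_norm.2 (by linarith [hnorm x hx])
  have hnS : ∀ x : ℝ, (x + T * I : ℂ) ∉ S := fun x h => (hS _ h).2 (by simp)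
  have hcong : ∀ x ∈ Set.uIcc (-1 : ℝ) 2, deriv f (x + T * I) / f (x + T * I) =
      ∑ ρ ∈ S, (zeroOrder f ρ : ℂ) * (x + T * I - ρ)⁻¹ +
        deriv g (x + T * I) / g (x + T * I) := fun x hx =>
    logDeriv_prod_zeros_mul hU hg hfg (hsub (hmem x hx))
      (fun h => hnS x (hzero _ (Metric.ball_subset_closedBall (hmem x hx)) h)) (hnS x)
  have hline : ∀ x : ℝ, HasDerivAt (fun x : ℝ => (x + T * I : ℂ)) 1 x := fun x =>
    (hasDerivAt_id (x : ℂ)).comp_ofReal.add_const _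
  have hLd : ∀ x ∈ Set.uIcc (-1 : ℝ) 2, HasDerivAt (fun x : ℝ => L (x + T * I))
      (deriv g (x + T * I) / g (x + T * I)) x := fun x hx => by
    have := (hL _ (hmem x hx)).comp x (hline x)
    rwa [mul_one] at this
  have hgc : ContinuousOn (fun x : ℝ => deriv g (x + T * I) / g (x + T * I))
      (Set.uIcc (-1 : ℝ) 2) := by
    intro x hx
    have hn := hU.mem_nhds (hsub (hmem x hx))
    have h1 : DifferentiableAt ℂ (fun z => deriv g z / g z) (x + T * I) :=
      ((hg.deriv hU).differentiableAt hn).div (hg.differentiableAt hn)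
        (hg0 _ (Metric.ball_subset_closedBall (hmem x hx)))
    exact (ContinuousAt.comp (f := fun x : ℝ => (x + T * I : ℂ)) h1.continuousAt
      (hline x).continuousAt).continuousWithinAt
  have hne : ∀ ρ ∈ S, ∀ x : ℝ, (x + T * I - ρ : ℂ) ≠ 0 := fun ρ hρ x h =>
    hnS x (by rw [sub_eq_zero.1 h]; exact hρ)
  have hcont : ∀ ρ ∈ S, Continuous (fun x : ℝ => (zeroOrder f ρ : ℂ) * (x + T * I - ρ)⁻¹) :=
    fun ρ hρ => Continuous.mul continuous_const (Continuous.inv₀ (by fun_prop) (hne ρ hρ))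
  have hterm : ∀ ρ ∈ S, |(∫ x : ℝ in (-1 : ℝ)..2, (x + T * I - ρ : ℂ)⁻¹).im| ≤ Real.pi := by
    intro ρ hρ
    have hd : ∀ t : ℝ, HasDerivAt (fun x : ℝ => (x + T * I - ρ : ℂ)) 1 t := fun t =>
      (hline t).sub_const ρ
    rcases lt_or_gt_of_ne (hS ρ hρ).2 with h | h
    · have := abs_im_integral_div_le_pi (a := -1) (b := 2) (-I) (fun t _ => hd t)
        continuousOn_const (fun t _ => by simpa using h)
      simpa only [one_div] using this
    · have := abs_im_integral_div_le_pi (a := -1) (b := 2) I (fun t _ => hd t)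
        continuousOn_const (fun t _ => by simpa using h)
      simpa only [one_div] using this
  rw [intervalIntegral.integral_congr hcong, intervalIntegral.integral_add
    ((continuous_finsetSum _ hcont).intervalIntegrable _ _) hgc.intervalIntegrable,
    intervalIntegral.integral_finsetSum fun ρ hρ => (hcont ρ hρ).intervalIntegrable _ _,
    intervalIntegral.integral_eq_sub_of_hasDerivAt hLd hgc.intervalIntegrable]
  simp only [intervalIntegral.integral_const_mul]
  have hend : ∀ x ∈ Set.uIcc (-1 : ℝ) 2, ‖L (x + T * I)‖ ≤ 6 * (Real.log Q + 1) := by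
    intro x hx
    refine (hLb _ (hmem x hx)).trans ?_
    have h1 := hnorm x hx
    have h2 := Real.log_nonneg hQ1
    rw [div_le_iff₀ (by linarith)]
    nlinarith [norm_nonneg ((x + T * I : ℂ) - (2 + T * I))]
  have e1 := hend _ Set.right_mem_uIcc
  have e2 := hend _ Set.left_mem_uIcc
  have e3 : |(∑ ρ ∈ S, (zeroOrder f ρ : ℂ) * ∫ x : ℝ in (-1 : ℝ)..2, (x + T * I - ρ : ℂ)⁻¹).im| ≤
      N * Real.pi := by
    rw [im_sum, hNdef, Nat.cast_sum, sum_mul]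
    refine (abs_sum_le_sum_abs _ _).trans (sum_le_sum fun ρ hρ => ?_)
    rw [← ofReal_natCast, im_ofReal_mul, abs_mul, abs_of_nonneg (Nat.cast_nonneg _)]
    gcongr
    exact hterm ρ hρ
  have e4 : (N : ℝ) ≤ 2 * Real.log Q := by
    have h1 := Real.log_le_log (by positivity) hN
    rw [Real.log_pow] at h1
    have h2 := Real.log_two_gt_d9
    nlinarith [(Nat.cast_nonneg N : (0 : ℝ) ≤ N)]
  rw [add_im, sub_im]
  have e5 := abs_im_le_norm (L ((2 : ℝ) + T * I))
  have e6 := abs_im_le_norm (L ((-1 : ℝ) + T * I))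
  have e7 := abs_add_le
    (∑ ρ ∈ S, (zeroOrder f ρ : ℂ) * ∫ x : ℝ in (-1 : ℝ)..2, (x + T * I - ρ : ℂ)⁻¹).im
    ((L ((2 : ℝ) + T * I)).im - (L ((-1 : ℝ) + T * I)).im)
  have e8 := abs_sub (L ((2 : ℝ) + T * I)).im (L ((-1 : ℝ) + T * I)).im
  nlinarith [Real.pi_lt_four, Real.pi_pos, (Nat.cast_nonneg N : (0 : ℝ) ≤ N)]

theorem meromorphic_riemannZeta : Meromorphic riemannZeta := by
  intro s
  rcases ne_or_eq s 1 with hs | rfl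
  · refine AnalyticAt.meromorphicAt ?_
    refine (DifferentiableOn.analyticAt (s := {1}ᶜ) (fun z hz =>
      (differentiableAt_riemannZeta hz).differentiableWithinAt) ?_)
    exact isOpen_compl_singleton.mem_nhds hs
  · have h0 : ∀ᶠ z : ℂ in nhdsWithin 1 {1}ᶜ, z ≠ 0 :=
      (isOpen_compl_singleton.eventually_mem (one_ne_zero (α := ℂ))).filter_mono
        nhdsWithin_le_nhds
    have hΓ : MeromorphicAt (fun z : ℂ => Gamma (z / 2)) 1 :=
      (Meromorphic.Gamma (1 / 2)).comp_analyticAt (g := fun z : ℂ => z / 2) (by fun_prop)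
    have hpi : AnalyticAt ℂ (fun z : ℂ => (Real.pi : ℂ) ^ (-z / 2)) 1 := by
      refine AnalyticAt.cpow analyticAt_const (by fun_prop) ?_
      simp [Real.pi_pos]
    have hΛ : MeromorphicAt completedRiemannZeta₀ 1 :=
      (differentiable_completedZeta₀.analyticAt 1).meromorphicAt
    refine MeromorphicAt.congr (f := fun z : ℂ => (completedRiemannZeta₀ z - 1 / z - 1 / (1 - z)) /
      ((Real.pi : ℂ) ^ (-z / 2) * Gamma (z / 2))) ?_ ?_
    · exact ((hΛ.sub (by fun_prop)).sub (by fun_prop)).div (hpi.meromorphicAt.mul hΓ)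
    · filter_upwards [h0] with z hz
      rw [riemannZeta_def_of_ne_zero hz, completedRiemannZeta_eq, Gammaℝ_def]

theorem meromorphic_omega : Meromorphic omega := by
  intro s
  have h1 : MeromorphicAt (fun s : ℂ => deriv Gamma s / Gamma s) s :=
    (Meromorphic.Gamma.logDeriv) s
  have h2 : MeromorphicAt (fun s : ℂ => tan (Real.pi * s / 2)) s :=
    (meromorphicAt_tan (Real.pi * s / 2)).comp_analyticAt (g := fun s : ℂ => Real.pi * s / 2)
      (by fun_prop)
  exact ((MeromorphicAt.const _ _).add h1).sub ((MeromorphicAt.const _ _).mul h2)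

theorem meromorphic_Zk (k : ℕ) : Meromorphic (Zk k) := by
  induction k with
  | zero => exact meromorphic_riemannZeta
  | succ k ih => exact fun s => (ih s).deriv.sub (((MeromorphicAt.const _ _).mul
      (meromorphic_omega s)).mul (ih s))

theorem eventually_Zk_ne_zero_right (k : ℕ) : ∀ᶠ s in stripFilter 2 2, Zk k s ≠ 0 := by
  filter_upwards [eventually_norm_Zk_div_sub_one_le k] with s hs h
  norm_num [h] at hs

theorem eventually_Zk_ne_zero_left (k : ℕ) : ∀ᶠ s in stripFilter (-1) (-1), Zk k s ≠ 0 := by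
  filter_upwards [eventually_norm_zetaFactor_mul_Zk_div_sub_one_le k] with s hs h
  norm_num [h] at hs

theorem exists_Zk_ne_zero (k : ℕ) : ∃ s : ℂ, 0 < s.im ∧ Zk k s ≠ 0 := by
  obtain ⟨t, ht⟩ := eventually_stripFilter.1 (eventually_Zk_ne_zero_right k)
  refine ⟨⟨2, max t 1⟩, by simp, ht _ ?_ ?_ ?_⟩ <;> simp

theorem eventually_nhdsNE_Zk_ne_zero (k : ℕ) (z : ℂ) :
    ∀ᶠ w in nhdsWithin z {z}ᶜ, Zk k w ≠ 0 := by
  obtain ⟨s, hs, h0⟩ := exists_Zk_ne_zero k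
  rw [← meromorphicOrderAt_ne_top_iff_eventually_ne_zero (meromorphic_Zk k z)]
  refine MeromorphicOn.meromorphicOrderAt_ne_top_of_isPreconnected (x := s) (U := Set.univ)
    (fun x _ => meromorphic_Zk k x) isPreconnected_univ trivial trivial ?_
  rw [meromorphicOrderAt_ne_top_iff_eventually_ne_zero (meromorphic_Zk k s)]
  exact ((differentiableAt_Zk k hs).continuousAt.eventually_ne h0).filter_mono nhdsWithin_le_nhds

theorem analyticOrderAt_Zk_ne_top (k : ℕ) (z : ℂ) : analyticOrderAt (Zk k) z ≠ ⊤ := by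
  intro h
  have h1 := (analyticOrderAt_eq_top.1 h).filter_mono (nhdsWithin_le_nhds (s := {z}ᶜ))
  obtain ⟨w, hw1, hw2⟩ := (h1.and (eventually_nhdsNE_Zk_ne_zero k z)).exists
  exact hw2 hw1

theorem finite_zeros_Zk (k : ℕ) {K : Set ℂ} (hK : IsCompact K) :
    {s | s ∈ K ∧ Zk k s = 0}.Finite := by
  by_contra h
  obtain ⟨z, -, hz⟩ := Set.Infinite.exists_accPt_of_subset_isCompact h hK fun s hs => hs.1
  rw [accPt_iff_frequently_nhdsNE] at hz
  exact hz ((eventually_nhdsNE_Zk_ne_zero k z).mono fun w hw h => hw h.2)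

theorem abs_re_vertical_integral_logDeriv_le_pi {U : Set ℂ} (hU : IsOpen U) {h : ℂ → ℂ}
    (hh : DifferentiableOn ℂ h U) {q c d : ℝ} (κ : ℂ)
    (hUq : ∀ y ∈ Set.uIcc c d, (q + y * I : ℂ) ∈ U)
    (hre : ∀ y ∈ Set.uIcc c d, 0 < (κ * h (q + y * I)).re) :
    IntervalIntegrable (fun y : ℝ => logDeriv h (q + y * I)) MeasureTheory.volume c d ∧
    |(∫ y : ℝ in c..d, logDeriv h (q + y * I)).re| ≤ Real.pi := by
  have hline : ∀ y : ℝ, HasDerivAt (fun y : ℝ => (q + y * I : ℂ)) I y := fun y => by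
    simpa using (((hasDerivAt_id y).ofReal_comp).mul_const I).const_add (q : ℂ)
  have hcl : ContinuousOn (fun y : ℝ => (q + y * I : ℂ)) (Set.uIcc c d) := by fun_prop
  have hcd : ContinuousOn (fun y : ℝ => deriv h (q + y * I)) (Set.uIcc c d) :=
    (hh.deriv hU).continuousOn.comp hcl hUq
  have hch : ContinuousOn (fun y : ℝ => h (q + y * I)) (Set.uIcc c d) :=
    hh.continuousOn.comp hcl hUq
  refine ⟨(hcd.div hch fun y hy h0 => ?_).intervalIntegrable, ?_⟩
  · have := hre y hy
    simp [h0] at this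
  · have := abs_im_integral_div_le_pi (F := fun y : ℝ => h (q + y * I))
      (F' := fun y : ℝ => I * deriv h (q + y * I)) (a := c) (b := d) κ ?_
      (continuousOn_const.mul hcd) hre
    · have h2 : ∫ y : ℝ in c..d, I * deriv h (q + y * I) / h (q + y * I) =
          I * ∫ y : ℝ in c..d, logDeriv h (q + y * I) := by
        rw [← intervalIntegral.integral_const_mul]
        simp only [logDeriv_apply, mul_div_assoc]
      rw [h2] at this
      simpa using this
    · intro y hy
      have := ((hh.differentiableAt (hU.mem_nhds (hUq y hy))).hasDerivAt).scomp y (hline y)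
      simpa [Function.comp_def] using this

/-- If `X * f = a ^ k * h` on a vertical segment with `Re a < 0` and `h` close to `1`, then the
variation of the argument of `X * f` along the segment is bounded. -/
theorem abs_re_vertical_integral_logDeriv_add_le {U : Set ℂ} (hU : IsOpen U) {f X a : ℂ → ℂ}
    (hf : DifferentiableOn ℂ f U) (hX : DifferentiableOn ℂ X U) (ha : DifferentiableOn ℂ a U)
    {q c d : ℝ} (k : ℕ) (hUq : ∀ y ∈ Set.uIcc c d, (q + y * I : ℂ) ∈ U)
    (hre : ∀ y ∈ Set.uIcc c d, (a (q + y * I)).re < 0)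
    (hh : ∀ y ∈ Set.uIcc c d,
      ‖X (q + y * I) * f (q + y * I) / a (q + y * I) ^ k - 1‖ ≤ 9 / 10) :
    |(∫ y : ℝ in c..d, (logDeriv f (q + y * I) + logDeriv X (q + y * I))).re|
      ≤ (k + 1) * Real.pi := by
  set V : Set ℂ := U ∩ a ⁻¹' {0}ᶜ
  have hV : IsOpen V := ha.continuousOn.isOpen_inter_preimage hU isOpen_compl_singleton
  have ha0 : ∀ y ∈ Set.uIcc c d, a (q + y * I) ≠ 0 := fun y hy h0 => by
    have := hre y hy
    simp [h0] at this
  have hVq : ∀ y ∈ Set.uIcc c d, (q + y * I : ℂ) ∈ V := fun y hy => ⟨hUq y hy, ha0 y hy⟩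
  set h : ℂ → ℂ := fun s => X s * f s / a s ^ k
  have hhd : DifferentiableOn ℂ h V := ((hX.mul hf).mono Set.inter_subset_left).div
    ((ha.mono Set.inter_subset_left).pow k) fun s hs => pow_ne_zero _ hs.2
  have hhre : ∀ y ∈ Set.uIcc c d, 0 < (1 * h (q + y * I)).re := fun y hy => by
    have h1 := (abs_le.1 ((abs_re_le_norm _).trans (hh y hy))).1
    simp only [sub_re, one_re] at h1
    rw [one_mul]
    change -(9 / 10) ≤ (h (q + y * I)).re - 1 at h1
    linarith
  have hare : ∀ y ∈ Set.uIcc c d, 0 < (-1 * a (q + y * I)).re := fun y hy => by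
    simpa using hre y hy
  obtain ⟨hi1, hb1⟩ := abs_re_vertical_integral_logDeriv_le_pi hV hhd 1 hVq hhre
  obtain ⟨hi2, hb2⟩ := abs_re_vertical_integral_logDeriv_le_pi hU ha (-1) hUq hare
  have hcong : ∀ y ∈ Set.uIcc c d, logDeriv f (q + y * I) + logDeriv X (q + y * I) =
      logDeriv h (q + y * I) + k * logDeriv a (q + y * I) := fun y hy => by
    have hn := hU.mem_nhds (hUq y hy)
    have hXf : X (q + y * I) * f (q + y * I) ≠ 0 := fun h0 => by
      have := hh y hy
      norm_num [h0] at this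
    have hap : DifferentiableAt ℂ a (q + y * I) := ha.differentiableAt hn
    have h1 : logDeriv h (q + y * I) = logDeriv (fun s => X s * f s) (q + y * I) -
        logDeriv (fun s => a s ^ k) (q + y * I) :=
      logDeriv_div _ hXf (pow_ne_zero _ (ha0 y hy))
        ((hX.differentiableAt hn).mul (hf.differentiableAt hn)) (hap.pow k)
    rw [h1, logDeriv_mul _ (left_ne_zero_of_mul hXf) (right_ne_zero_of_mul hXf)
      (hX.differentiableAt hn) (hf.differentiableAt hn), logDeriv_fun_pow hap]
    ring
  rw [intervalIntegral.integral_congr hcong, intervalIntegral.integral_add hi1 (hi2.const_mul _),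
    intervalIntegral.integral_const_mul, add_re, ← ofReal_natCast, re_ofReal_mul]
  refine (abs_add_le _ _).trans ?_
  rw [abs_mul, Nat.abs_cast, add_mul, add_comm, one_mul]
  gcongr

theorem eventually_nhdsGT_Zk_ne_zero (k : ℕ) (B T : ℝ) :
    ∀ᶠ T' in nhdsWithin T (Set.Ioi T), ∀ s : ℂ, |s.re| ≤ B → T < s.im → s.im ≤ T' →
      Zk k s ≠ 0 := by
  have hfin := finite_zeros_Zk k
    ((isCompact_Icc (a := -B) (b := B)).reProdIm (isCompact_Icc (a := T) (b := T + 1)))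
  have h1 : ∀ᶠ T' in nhdsWithin T (Set.Ioi T), ∀ s ∈ {s | s ∈ Set.Icc (-B) B ×ℂ Set.Icc T (T + 1) ∧
      Zk k s = 0}, T < s.im → T' < s.im := by
    rw [Filter.eventually_all_finite hfin]
    intro s _
    by_cases hs : T < s.im
    · filter_upwards [(eventually_lt_nhds hs).filter_mono nhdsWithin_le_nhds] with T' h _ using h
    · exact Filter.Eventually.of_forall fun T' h => absurd h hs
  filter_upwards [h1, (eventually_lt_nhds (lt_add_one T)).filter_mono nhdsWithin_le_nhds]
    with T' h2 h3 s hsB hs1 hs2 h0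
  refine (h2 s ⟨?_, h0⟩ hs1).not_ge hs2
  rw [mem_reProdIm]
  exact ⟨abs_le.1 hsB, hs1.le, by linarith⟩

theorem exists_Zk_ne_zero_im_eq (k : ℕ) (B t : ℝ) :
    ∃ T > t, ∀ s : ℂ, |s.re| ≤ B → s.im = T → Zk k s ≠ 0 := by
  obtain ⟨T, h1, h2⟩ := ((eventually_nhdsGT_Zk_ne_zero k B t).and self_mem_nhdsWithin).exists
  exact ⟨T, h2, fun s hs h => h1 s hs (h ▸ h2) h.le⟩

theorem differentiableOn_Zk (k : ℕ) : DifferentiableOn ℂ (Zk k) {s | 0 < s.im} :=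
  fun _ hs => (differentiableAt_Zk k hs).differentiableWithinAt

theorem exists_abs_right_integral_le (k : ℕ) : ∃ t₀ : ℝ, ∀ c d : ℝ, t₀ ≤ c → c ≤ d →
    |(∫ y : ℝ in c..d, logDeriv (Zk k) ((2 : ℝ) + y * I)).re| ≤ (k + 1) * Real.pi := by
  obtain ⟨t₁, h₁⟩ := eventually_stripFilter.1 (eventually_norm_Zk_div_sub_one_le k)
  obtain ⟨t₂, h₂⟩ := eventually_stripFilter.1 (eventually_rightCoeff_re_le 2 1)
  refine ⟨max 1 (max t₁ t₂), fun c d hc hcd => ?_⟩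
  simp only [max_le_iff] at hc
  obtain ⟨hc0, hc1, hc2⟩ := hc
  have := abs_re_vertical_integral_logDeriv_add_le isOpen_im_pos (differentiableOn_Zk k)
    (X := fun _ => 1) (a := rightCoeff) (differentiableOn_const _)
    (fun s hs => (differentiableAt_rightCoeff hs).differentiableWithinAt) (q := 2) (c := c) (d := d)
    k ?_ ?_ ?_
  · simpa [logDeriv_apply] using this
  all_goals
    intro y hy
    rw [Set.uIcc_of_le hcd] at hy
  · simp only [Set.mem_ofPred_eq, add_im, ofReal_im, mul_im, ofReal_re, I_im, I_re]
    linarith [hy.1]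
  · refine (h₂ _ ?_ ?_ ?_).trans_lt (by norm_num) <;> simp
    linarith [hy.1]
  · rw [one_mul]
    refine h₁ _ ?_ ?_ ?_ <;> simp
    linarith [hy.1]

theorem exists_abs_left_integral_le (k : ℕ) : ∃ t₀ : ℝ, ∃ C > 0, ∀ c d : ℝ, t₀ ≤ c → c ≤ d →
    |(∫ y : ℝ in c..d, logDeriv (Zk k) ((-1 : ℝ) + y * I)).re +
      ∫ y : ℝ in c..d, (Real.log y - Real.log (2 * Real.pi))|
      ≤ (k + 1) * Real.pi + C * (Real.log d - Real.log c) := by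
  obtain ⟨t₁, h₁⟩ := eventually_stripFilter.1 (eventually_norm_zetaFactor_mul_Zk_div_sub_one_le k)
  obtain ⟨t₂, h₂⟩ := eventually_stripFilter.1 (eventually_leftCoeff_re_le 1 1)
  obtain ⟨C, hC, hω⟩ := exists_norm_omega_sub_le le_rfl
  refine ⟨max 2 (max t₁ t₂), C, hC, fun c d hc hcd => ?_⟩
  simp only [max_le_iff] at hc
  obtain ⟨hc0, hc1, hc2⟩ := hc
  have hUq : ∀ y ∈ Set.uIcc c d, (((-1 : ℝ) : ℂ) + y * I) ∈ {s : ℂ | 0 < s.im} := fun y hy => by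
    rw [Set.uIcc_of_le hcd] at hy
    simp only [Set.mem_ofPred_eq, add_im, ofReal_im, mul_im, ofReal_re, I_im, I_re]
    linarith [hy.1]
  have hnear : ∀ y ∈ Set.uIcc c d, ‖zetaFactor ((-1 : ℝ) + y * I) * Zk k ((-1 : ℝ) + y * I) /
      leftCoeff ((-1 : ℝ) + y * I) ^ k - 1‖ ≤ 9 / 10 := fun y hy => by
    rw [Set.uIcc_of_le hcd] at hy
    refine h₁ _ ?_ ?_ ?_ <;> simp
    linarith [hy.1]
  have hmain := abs_re_vertical_integral_logDeriv_add_le isOpen_im_pos (differentiableOn_Zk k)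
    (X := zetaFactor) (a := leftCoeff)
    (fun s hs => (hasDerivAt_zetaFactor hs).differentiableAt.differentiableWithinAt)
    (fun s hs => (differentiableAt_leftCoeff hs).differentiableWithinAt) (q := -1) (c := c) (d := d)
    k hUq ?_ hnear
  swap
  · intro y hy
    rw [Set.uIcc_of_le hcd] at hy
    refine (h₂ _ ?_ ?_ ?_).trans_lt (by norm_num) <;> simp
    linarith [hy.1]
  have hcl : ContinuousOn (fun y : ℝ => ((-1 : ℝ) + y * I : ℂ)) (Set.uIcc c d) := by fun_prop
  have hi1 : IntervalIntegrable (fun y : ℝ => logDeriv (Zk k) ((-1 : ℝ) + y * I))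
      MeasureTheory.volume c d := by
    refine ContinuousOn.intervalIntegrable ?_
    refine ((((differentiableOn_Zk k).deriv isOpen_im_pos).continuousOn.comp hcl hUq).div
      ((differentiableOn_Zk k).continuousOn.comp hcl hUq)) fun y hy h0 => ?_
    have := hnear y hy
    rw [show Zk k ((-1 : ℝ) + y * I) = 0 from h0] at this
    norm_num at this
  have hX : ∀ y ∈ Set.uIcc c d, logDeriv zetaFactor ((-1 : ℝ) + y * I) =
      omega ((-1 : ℝ) + y * I) - 2 * Real.log (2 * Real.pi) := fun y hy => by
    rw [logDeriv_apply, (hasDerivAt_zetaFactor (hUq y hy)).deriv,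
      mul_div_cancel_right₀ _ (zetaFactor_ne_zero (hUq y hy))]
  have hωd : DifferentiableOn ℂ omega {s | 0 < s.im} :=
    fun s hs => (differentiableAt_omega hs).differentiableWithinAt
  have hi2 : IntervalIntegrable (fun y : ℝ => omega ((-1 : ℝ) + y * I) - 2 * Real.log (2 * Real.pi))
      MeasureTheory.volume c d :=
    ((hωd.continuousOn.comp hcl hUq).sub continuousOn_const).intervalIntegrable
  have hlogc : ContinuousOn (fun y : ℝ => Real.log y - Real.log (2 * Real.pi)) (Set.uIcc c d) :=
    (Real.continuousOn_log.mono fun y hy => by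
      rw [Set.uIcc_of_le hcd] at hy
      exact ne_of_gt (by linarith [hy.1])).sub continuousOn_const
  have hi3 : IntervalIntegrable (fun y : ℝ => ((Real.log y - Real.log (2 * Real.pi) : ℝ) : ℂ))
      MeasureTheory.volume c d :=
    (continuous_ofReal.comp_continuousOn hlogc).intervalIntegrable
  have hbound : ‖∫ y : ℝ in c..d, ((omega ((-1 : ℝ) + y * I) - 2 * Real.log (2 * Real.pi)) -
      ((Real.log y - Real.log (2 * Real.pi) : ℝ) : ℂ))‖ ≤ C * (Real.log d - Real.log c) := by
    have hval : ∫ y in c..d, C / y = C * (Real.log d - Real.log c) := by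
      simp_rw [div_eq_mul_inv]
      rw [intervalIntegral.integral_const_mul, integral_inv_of_pos (by linarith) (by linarith),
        Real.log_div (by linarith) (by linarith)]
    rw [← hval]
    refine intervalIntegral.norm_integral_le_of_norm_le hcd
      (MeasureTheory.ae_of_all _ fun y hy => ?_) ?_
    · have := hω ((-1 : ℝ) + y * I) (by simp) (by simp; linarith [hy.1])
      simp only [add_im, ofReal_im, mul_im, ofReal_re, I_im, I_re, mul_zero, mul_one, zero_add,
        add_zero] at this
      refine le_of_eq_of_le (congrArg norm ?_) this
      push_cast
      ring
    · exact (continuousOn_const.div continuousOn_id fun y hy => by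
        rw [Set.uIcc_of_le hcd] at hy
        exact ne_of_gt (by simp only [id]; linarith [hy.1])).intervalIntegrable
  rw [intervalIntegral.integral_add hi1 (hi2.congr_uIoo fun y hy => (hX y ?_).symm),
    intervalIntegral.integral_congr hX, add_re] at hmain
  swap
  · exact Set.uIoo_subset_uIcc_self hy
  rw [intervalIntegral.integral_sub hi2 hi3, intervalIntegral.integral_ofReal] at hbound
  have hb2 := (abs_re_le_norm _).trans hbound
  rw [sub_re, ofReal_re] at hb2
  rw [abs_le] at hmain hb2 ⊢
  constructor <;> linarith [hmain.1, hmain.2, hb2.1, hb2.2]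

theorem exists_abs_horizontal_integral_le (k : ℕ) : ∃ t₀ : ℝ, ∃ K > 0, ∀ T : ℝ, t₀ ≤ T →
    (∀ s : ℂ, |s.re| ≤ 6 → s.im = T → Zk k s ≠ 0) →
    |(∫ x in (-1:ℝ)..2, logDeriv (Zk k) (x + T * I)).im| ≤ K * Real.log T := by
  obtain ⟨A, hA⟩ := exists_eventually_norm_Zk_le k 14 (by norm_num)
  obtain ⟨t₀, h₀⟩ := eventually_stripFilter.1 hA
  obtain ⟨t₁, h₁⟩ := eventually_stripFilter.1 (eventually_norm_Zk_div_sub_one_le k)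
  obtain ⟨t₂, h₂⟩ := eventually_stripFilter.1 (eventually_rightCoeff_re_le 2 1)
  refine ⟨max 13 (max (t₀ + 12) (max t₁ t₂)), 40 * A + 252, by positivity, fun T hT hgen => ?_⟩
  simp only [max_le_iff] at hT
  obtain ⟨hT13, hT0, hT1, hT2⟩ := hT
  have hball : ∀ r : ℝ, ∀ z ∈ Metric.closedBall ((2 : ℂ) + T * I) r,
      |z.re - 2| ≤ r ∧ |z.im - T| ≤ r := fun r z hz => by
    rw [mem_closedBall_iff_norm] at hz
    exact ⟨by simpa using (abs_re_le_norm _).trans hz, by simpa using (abs_im_le_norm _).trans hz⟩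
  have hlow : 1 / 10 ≤ ‖Zk k (2 + T * I)‖ := by
    have ha := h₂ (2 + T * I) (by simp) (by simp) (by simpa using hT2)
    have hh := h₁ (2 + T * I) (by simp) (by simp) (by simpa using hT1)
    have ha1 : 1 ≤ ‖rightCoeff (2 + T * I)‖ := by
      have := (abs_re_le_norm (rightCoeff (2 + T * I)))
      rw [abs_le] at this
      linarith [this.1]
    have hq : 1 / 10 ≤ ‖Zk k (2 + T * I) / rightCoeff (2 + T * I) ^ k‖ := by
      have := norm_sub_norm_le (1 : ℂ) (Zk k (2 + T * I) / rightCoeff (2 + T * I) ^ k)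
      rw [norm_sub_rev, norm_one] at this
      linarith
    rw [norm_div, norm_pow] at hq
    refine hq.trans (div_le_self (norm_nonneg _) (one_le_pow₀ ha1))
  have hfin := finite_zeros_Zk k (isCompact_closedBall ((2 : ℂ) + T * I) 4)
  have hmain := abs_im_horizontal_integral_logDeriv_le isOpen_im_pos (differentiableOn_Zk k)
    (T := T) (M := (T + 12) ^ A) (fun z hz => ?_) (fun z hz => ?_)
    (norm_pos_iff.1 (by linarith)) (S := hfin.toFinset) (fun ρ hρ => ?_)
    (fun ρ _ => analyticOrderAt_Zk_ne_top k ρ) (fun z hz h => by simpa using ⟨hz, h⟩)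
  · have hlogT : 1 ≤ Real.log T := by
      rw [Real.le_log_iff_exp_le (by linarith)]
      linarith [Real.exp_one_lt_d9]
    have h1 : Real.log ((T + 12) ^ A / ‖Zk k (2 + T * I)‖) ≤ A * (2 * Real.log T) + 10 := by
      rw [Real.log_div (by positivity) (by linarith), Real.log_pow]
      have h2 : Real.log (T + 12) ≤ 2 * Real.log T := by
        rw [← Nat.cast_two, ← Real.log_pow]
        exact Real.log_le_log (by linarith) (by nlinarith)
      have h3 : -10 ≤ Real.log ‖Zk k (2 + T * I)‖ := by
        have := Real.log_le_log (by norm_num) hlow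
        rw [one_div, Real.log_inv] at this
        linarith [Real.log_le_self (x := 10) (by norm_num)]
      have : A * Real.log (T + 12) ≤ A * (2 * Real.log T) := by gcongr
      linarith
    simp only [logDeriv_apply]
    refine hmain.trans ?_
    nlinarith
  · have := abs_le.1 (hball _ z hz).2
    simp only [Set.mem_ofPred_eq]
    linarith [this.1]
  · have h1 := abs_le.1 (hball _ z hz).1
    have h2 := abs_le.1 (hball _ z hz).2
    refine (h₀ z (by linarith [h1.1]) (by linarith [h1.2]) (by linarith [h2.1])).trans ?_
    gcongr
    · linarith [h2.1]
    · linarith [h2.2]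
  · rw [Set.Finite.mem_toFinset] at hρ
    refine ⟨hρ.1, fun h => hgen ρ ?_ h hρ.2⟩
    have h1 := abs_le.1 (hball _ ρ hρ.1).1
    rw [abs_le]
    constructor <;> linarith [h1.1, h1.2]

theorem exists_abs_sum_zeroOrder_sub_le (k : ℕ) : ∃ T₀ ≥ (3 : ℝ), ∃ K > (0 : ℝ), ∀ T > T₀,
    (∀ s : ℂ, |s.re| ≤ 6 → s.im = T → Zk k s ≠ 0) → ∀ S : Finset ℂ,
    (∀ s, s ∈ S ↔ Zk k s = 0 ∧ -1 < s.re ∧ s.re < 2 ∧ T₀ < s.im ∧ s.im < T) →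
    |(∑ ρ ∈ S, (zeroOrder (Zk k) ρ : ℝ)) - T / (2 * Real.pi) * Real.log (T / (2 * Real.pi))
      + T / (2 * Real.pi)| ≤ K * Real.log T := by
  obtain ⟨t₁, h₁⟩ := exists_abs_right_integral_le k
  obtain ⟨t₂, C, hC, h₂⟩ := exists_abs_left_integral_le k
  obtain ⟨t₃, H, hH, h₃⟩ := exists_abs_horizontal_integral_le k
  obtain ⟨t₄, h₄⟩ := eventually_stripFilter.1 (eventually_Zk_ne_zero_right k)
  obtain ⟨t₅, h₅⟩ := eventually_stripFilter.1 (eventually_Zk_ne_zero_left k)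
  obtain ⟨T₀, hT₀, hgen₀⟩ := exists_Zk_ne_zero_im_eq k 6
    (max 3 (max t₁ (max t₂ (max t₃ (max t₄ t₅)))))
  simp only [gt_iff_lt, max_lt_iff] at hT₀
  obtain ⟨h30, h10, h20, h30', h40, h50⟩ := hT₀
  set D := T₀ * Real.log T₀ - T₀ - Real.log (2 * Real.pi) * T₀ with hD
  refine ⟨T₀, h30.le, 2 * H + 2 * ((k + 1) * Real.pi) + C + |D|, by positivity,
    fun T hT hgen S hS => ?_⟩
  have hzero : ∀ z : ℂ, -1 ≤ z.re → z.re ≤ 2 → T₀ ≤ z.im → z.im ≤ T → Zk k z = 0 → z ∈ S := by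
    intro z hz1 hz2 hz3 hz4 hz
    have hz6 : |z.re| ≤ 6 := abs_le.2 ⟨by linarith, by linarith⟩
    refine (hS z).2 ⟨hz, lt_of_le_of_ne hz1 fun h => ?_, lt_of_le_of_ne hz2 fun h => ?_,
      lt_of_le_of_ne hz3 fun h => hgen₀ z hz6 h.symm hz, lt_of_le_of_ne hz4 fun h => hgen z hz6 h hz⟩
    · exact h₅ z h.le h.ge (by linarith) hz
    · exact h₄ z h.ge h.le (by linarith) hz
  have hcount := rectIntegral_logDeriv isOpen_im_pos (differentiableOn_Zk k) (a := -1) (b := 2)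
    (c := T₀) (d := T) (by norm_num) hT.le
    (fun z _ _ h _ => show 0 < z.im by linarith) (fun ρ hρ => ((hS ρ).1 hρ).2)
    (fun ρ _ => analyticOrderAt_Zk_ne_top k ρ) hzero
  have him := congrArg Complex.im hcount
  have hN : (2 * (Real.pi : ℂ) * I * ∑ ρ ∈ S, (zeroOrder (Zk k) ρ : ℂ)).im =
      2 * Real.pi * ∑ ρ ∈ S, (zeroOrder (Zk k) ρ : ℝ) := by
    rw [show (2 * (Real.pi : ℂ) * I * ∑ ρ ∈ S, (zeroOrder (Zk k) ρ : ℂ)) =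
      ((2 * Real.pi * ∑ ρ ∈ S, (zeroOrder (Zk k) ρ : ℝ) : ℝ) : ℂ) * I by push_cast; ring]
    rw [im_ofReal_mul, I_im, mul_one]
  rw [hN] at him
  simp only [rectIntegral, sub_im, add_im, I_mul_im, ← logDeriv_apply] at him
  have hb := h₃ T₀ h30'.le hgen₀
  have ht := h₃ T (by linarith) hgen
  have hr := h₁ T₀ T h10.le hT.le
  have hl := h₂ T₀ T h20.le hT.le
  have hTpos : 0 < T := by linarith
  have hlog0 : 1 ≤ Real.log T₀ := by
    rw [Real.le_log_iff_exp_le (by linarith)]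
    linarith [Real.exp_one_lt_d9]
  have hlog1 : Real.log T₀ ≤ Real.log T := Real.log_le_log (by linarith) hT.le
  have hval : ∫ y : ℝ in T₀..T, (Real.log y - Real.log (2 * Real.pi)) =
      T * Real.log T - T - Real.log (2 * Real.pi) * T - D := by
    rw [intervalIntegral.integral_sub intervalIntegral.intervalIntegrable_log'
      intervalIntegrable_const, integral_log, intervalIntegral.integral_const, smul_eq_mul]
    ring
  rw [hval] at hl
  have hpi : 1 ≤ 2 * Real.pi := by linarith [Real.pi_gt_three]
  have key : |2 * Real.pi * (∑ ρ ∈ S, (zeroOrder (Zk k) ρ : ℝ)) -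
      (T * Real.log T - T - Real.log (2 * Real.pi) * T)| ≤
      (2 * H + 2 * ((k + 1) * Real.pi) + C + |D|) * Real.log T := by
    have e1 : H * Real.log T₀ ≤ H * Real.log T := by gcongr
    have e2 : (k + 1) * Real.pi ≤ (k + 1) * Real.pi * Real.log T :=
      le_mul_of_one_le_right (by positivity) (hlog0.trans hlog1)
    have e3 : C * (Real.log T - Real.log T₀) ≤ C * Real.log T := by gcongr; linarith
    have e4 : |D| ≤ |D| * Real.log T :=
      le_mul_of_one_le_right (abs_nonneg _) (hlog0.trans hlog1)
    have e5 := neg_abs_le D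
    have e6 := le_abs_self D
    rw [abs_le] at hb ht hr hl ⊢
    constructor <;> linarith [hb.1, hb.2, ht.1, ht.2, hr.1, hr.2, hl.1, hl.2]
  have hfac : 2 * Real.pi * (∑ ρ ∈ S, (zeroOrder (Zk k) ρ : ℝ)) -
      (T * Real.log T - T - Real.log (2 * Real.pi) * T) = 2 * Real.pi *
      ((∑ ρ ∈ S, (zeroOrder (Zk k) ρ : ℝ)) - T / (2 * Real.pi) * Real.log (T / (2 * Real.pi))
      + T / (2 * Real.pi)) := by
    rw [Real.log_div (by positivity) (by positivity)]
    field_simp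
    ring
  rw [hfac, abs_mul, abs_of_pos (by positivity : 0 < 2 * Real.pi)] at key
  exact (le_mul_of_one_le_left (abs_nonneg _) hpi).trans key

theorem continuousAt_mul_log_sub {T : ℝ} (hT : 0 < T) :
    ContinuousAt (fun T : ℝ => T / (2 * Real.pi) * Real.log (T / (2 * Real.pi)) -
      T / (2 * Real.pi)) T := by
  have hc : ContinuousAt (fun T : ℝ => T / (2 * Real.pi)) T := by fun_prop
  exact (hc.mul (hc.log (by positivity))).sub hc

/-- the Riemann–von Mangoldt type formula for the zeros of `Z_k` in the region
`1 − 2m < σ < 2m`, `0 ≤ t ≤ T`, counted with multiplicity. -/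
theorem zero_counting_Zk (k : ℕ) :
    ∃ m : ℕ, 0 < m ∧ ∃ C > (0 : ℝ), ∀ T : ℝ, 2 ≤ T →
      ∃ hfin : {s : ℂ | Zk k s = 0 ∧ 1 - 2 * (m : ℝ) < s.re ∧ s.re < 2 * (m : ℝ) ∧
          0 ≤ s.im ∧ s.im ≤ T}.Finite,
        |(∑ ρ ∈ hfin.toFinset, (zeroOrder (Zk k) ρ : ℝ))
            - T / (2 * Real.pi) * Real.log (T / (2 * Real.pi)) + T / (2 * Real.pi)|
          ≤ C * Real.log T := by
  obtain ⟨T₀, hT₀, K, hK, hcount⟩ := exists_abs_sum_zeroOrder_sub_le k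
  set F : ℝ → ℝ := fun T => T / (2 * Real.pi) * Real.log (T / (2 * Real.pi)) - T / (2 * Real.pi)
  have hsub : ∀ N T : ℝ, N - T / (2 * Real.pi) * Real.log (T / (2 * Real.pi)) +
      T / (2 * Real.pi) = N - F T := fun N T => by simp only [F]; ring
  have hfinT : ∀ T : ℝ, {s : ℂ | Zk k s = 0 ∧ 1 - 2 * ((1 : ℕ) : ℝ) < s.re ∧
      s.re < 2 * ((1 : ℕ) : ℝ) ∧ 0 ≤ s.im ∧ s.im ≤ T}.Finite := fun T => by
    refine (finite_zeros_Zk k ((isCompact_Icc (a := (-1 : ℝ)) (b := 2)).reProdIm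
      (isCompact_Icc (a := (0 : ℝ)) (b := T)))).subset fun s hs => ?_
    obtain ⟨h0, h1, h2, h3, h4⟩ := hs
    norm_num at h1 h2
    exact ⟨mem_reProdIm.2 ⟨⟨h1.le, h2.le⟩, h3, h4⟩, h0⟩
  set N : ℝ → ℝ := fun T => ∑ ρ ∈ (hfinT T).toFinset, (zeroOrder (Zk k) ρ : ℝ)
  have hN0 : ∀ T, 0 ≤ N T := fun T => sum_nonneg fun _ _ => Nat.cast_nonneg _
  obtain ⟨B, hB⟩ := (isCompact_Icc (a := (2 : ℝ)) (b := T₀)).exists_bound_of_continuousOn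
    (f := F) fun T hT => (continuousAt_mul_log_sub (by linarith [hT.1])).continuousWithinAt
  have hB0 : 0 ≤ B := (norm_nonneg _).trans (hB 2 ⟨le_rfl, by linarith⟩)
  have hlog2 : (1 : ℝ) / 2 ≤ Real.log 2 := by linarith [Real.log_two_gt_d9]
  refine ⟨1, one_pos, 2 * (N T₀ + B + 1) + 2 * K, by linarith [hN0 T₀], fun T hT =>
    ⟨hfinT T, ?_⟩⟩
  rw [hsub]
  change |N T - F T| ≤ _
  have hlogT : 1 / 2 ≤ Real.log T := hlog2.trans (Real.log_le_log (by norm_num) hT)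
  have hb1 : N T₀ + B + 1 ≤ 2 * (N T₀ + B + 1) * Real.log T := by nlinarith [hN0 T₀]
  rcases le_or_gt T T₀ with hle | hgt
  · have hNle : N T ≤ N T₀ := by
      refine sum_le_sum_of_subset_of_nonneg ?_ fun _ _ _ => Nat.cast_nonneg _
      refine Set.Finite.toFinset_subset_toFinset.2 fun s hs => ?_
      exact ⟨hs.1, hs.2.1, hs.2.2.1, hs.2.2.2.1, hs.2.2.2.2.trans hle⟩
    have h1 := hB T ⟨hT, hle⟩
    rw [Real.norm_eq_abs, abs_le] at h1
    have h2 : 0 ≤ 2 * K * Real.log T := by positivity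
    rw [abs_le]
    constructor <;> nlinarith [hN0 T, hN0 T₀, h1.1, h1.2]
  · have hTpos : 0 < T := by linarith
    have hF : ∀ᶠ T' in nhdsWithin T (Set.Ioi T), |F T' - F T| < 1 := by
      have := (continuousAt_mul_log_sub hTpos).tendsto.eventually (Metric.ball_mem_nhds (F T) one_pos)
      exact (this.filter_mono nhdsWithin_le_nhds).mono fun _ h => h
    have hL : ∀ᶠ T' in nhdsWithin T (Set.Ioi T), T' < T + 1 :=
      (eventually_lt_nhds (lt_add_one T)).filter_mono nhdsWithin_le_nhds
    obtain ⟨T', ⟨⟨hz, hF'⟩, hL'⟩, hTT'⟩ := (((eventually_nhdsGT_Zk_ne_zero k 6 T).and hF).and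
      hL).and self_mem_nhdsWithin |>.exists
    have hTT' : T < T' := hTT'
    set S := (hfinT T).toFinset \ (hfinT T₀).toFinset with hS
    have hsum : (∑ ρ ∈ S, (zeroOrder (Zk k) ρ : ℝ)) + N T₀ = N T := by
      refine sum_sdiff (Set.Finite.toFinset_subset_toFinset.2 fun s hs => ?_)
      exact ⟨hs.1, hs.2.1, hs.2.2.1, hs.2.2.2.1, hs.2.2.2.2.trans hgt.le⟩
    have hmem : ∀ s, s ∈ S ↔ Zk k s = 0 ∧ -1 < s.re ∧ s.re < 2 ∧ T₀ < s.im ∧ s.im < T' := by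
      intro s
      simp only [hS, mem_sdiff, Set.Finite.mem_toFinset, Set.mem_ofPred_eq]
      norm_num
      constructor
      · rintro ⟨⟨h0, h1, h2, h3, h4⟩, h5⟩
        exact ⟨h0, h1, h2, h5 h0 h1 h2 h3, by linarith⟩
      · rintro ⟨h0, h1, h2, h3, h4⟩
        refine ⟨⟨h0, h1, h2, by linarith, ?_⟩, fun _ _ _ _ => h3⟩
        by_contra! h5
        exact hz s (abs_le.2 ⟨by linarith, by linarith⟩) h5 h4.le h0
    have h1 := hcount T' (by linarith) (fun s hs h => hz s hs (h ▸ hTT') h.le) S hmem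
    rw [hsub] at h1
    have h2 : Real.log T' ≤ 2 * Real.log T := by
      rw [← Nat.cast_two, ← Real.log_pow]
      exact Real.log_le_log (by linarith) (by nlinarith)
    have h3 : K * Real.log T' ≤ K * (2 * Real.log T) := by gcongr
    rw [abs_le] at h1 ⊢
    rw [abs_lt] at hF'
    constructor <;> linarith [h1.1, h1.2, hF'.1, hF'.2, hN0 T₀]
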